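/- Let p be a prime with ω(p−1) ≥ 42. Then g(p) ≤ √p − 2. -/

import Mathlib

/-- The least primitive root modulo `p`: the smallest positive integer whose
residue class has order `p - 1` in `ZMod p` (equivalently, generates `(ZMod p)ˣ`). -/
noncomputable def leastPrimitiveRoot (p : ℕ) : ℕ :=
  sInf {n : ℕ | 0 < n ∧ orderOf ((n : ZMod p)) = p - 1}

open Polynomial

section Stepanov

/-- The derivation sending `P` to `W` times the derivative of `P`. -/
noncomputable def scaledDerivative {R : Type*} [CommRing R] (W : R[X]) (P : R[X]) : R[X] :=
  W * derivative P

lemma scaledDerivative_iterate_pow_mul {R : Type*} [CommRing R] (W u : R[X]) (x : R) (r j : ℕ)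
    (hj : j ≤ r) : ∃ v : R[X],
      (scaledDerivative W)^[j] ((X - C x) ^ r * u) = (X - C x) ^ (r - j) * v ∧
      v.eval x = r.descFactorial j * (W.eval x) ^ j * u.eval x := by
  induction j with
  | zero => exact ⟨u, by simp, by simp⟩
  | succ j ih =>
    obtain ⟨v, hv, hvx⟩ := ih (by omega)
    obtain ⟨t, ht⟩ : ∃ t, r - j = t + 1 := ⟨r - j - 1, by omega⟩
    have ht' : r - (j + 1) = t := by omega
    refine ⟨W * (C ((t + 1 : ℕ) : R) * v + (X - C x) * derivative v), ?_, ?_⟩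
    · rw [Function.iterate_succ_apply', hv, scaledDerivative, ht, ht']
      simp only [derivative_mul, derivative_X_sub_C_pow]
      simp only [Nat.add_sub_cancel, pow_succ, map_natCast]
      ring
    · simp only [eval_mul, eval_add, eval_sub, eval_X, eval_C, sub_self, zero_mul, add_zero, hvx]
      rw [Nat.descFactorial_succ, ht]
      push_cast
      ring

lemma pow_dvd_of_scaledDerivative_iterate_eval_eq_zero {p : ℕ} [Fact p.Prime]
    (W P : (ZMod p)[X]) (x : ZMod p)
    (hW : W.eval x ≠ 0) (M : ℕ) (hM : M ≤ p)
    (h : ∀ k < M, ((scaledDerivative W)^[k] P).eval x = 0) : (X - C x) ^ M ∣ P := by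
  induction M with
  | zero => simp
  | succ k ih =>
    obtain ⟨u, rfl⟩ := ih (by omega) (fun j hj => h j (by omega))
    obtain ⟨v, hv, hvx⟩ := scaledDerivative_iterate_pow_mul W u x k k le_rfl
    have h0 := h k (by omega)
    rw [hv, Nat.sub_self, pow_zero, one_mul, hvx, Nat.descFactorial_self] at h0
    have hf : ((k.factorial : ℕ) : ZMod p) ≠ 0 := by
      rw [Ne, ZMod.natCast_eq_zero_iff, (Fact.out : p.Prime).dvd_factorial]
      omega
    have hu : u.eval x = 0 := by
      simpa [hf, hW] using h0
    obtain ⟨w, rfl⟩ := dvd_iff_isRoot.2 hu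
    exact ⟨w, by ring⟩

/-- The operator such that the derivation takes `Q F₁ ^ a F₂ ^ b` to `(twist Q) F₁ ^ a F₂ ^ b`, for
`W = F₁ F₂`. -/
noncomputable def twist {R : Type*} [CommRing R] (F₁ F₂ : R[X]) (a b : ℕ) (Q : R[X]) : R[X] :=
  F₁ * F₂ * derivative Q + (a * (derivative F₁ * F₂) + b * (F₁ * derivative F₂)) * Q

lemma scaledDerivative_iterate_term {p : ℕ} [Fact p.Prime] (F₁ F₂ Q : (ZMod p)[X]) (a b j k : ℕ) :
    (scaledDerivative (F₁ * F₂))^[k] (X ^ (p * j) * Q * F₁ ^ a * F₂ ^ b) =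
      X ^ (p * j) * (twist F₁ F₂ a b)^[k] Q * F₁ ^ a * F₂ ^ b := by
  have hpow : ∀ (F : (ZMod p)[X]) (n : ℕ), F * derivative (F ^ n) = n * derivative F * F ^ n := by
    intro F n
    cases n with
    | zero => simp
    | succ n => rw [derivative_pow_succ]; push_cast; simp only [map_add, map_natCast, map_one]; ring
  induction k with
  | zero => rfl
  | succ k ih =>
    rw [Function.iterate_succ_apply', Function.iterate_succ_apply', ih]
    set T := (twist F₁ F₂ a b)^[k] Q
    have h1 := hpow F₁ a
    have h2 := hpow F₂ b
    have h3 : derivative (X ^ (p * j) : (ZMod p)[X]) = 0 := by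
      rw [derivative_X_pow]; simp
    simp only [scaledDerivative, twist, derivative_mul, h3]
    linear_combination (X ^ (p * j) * T * F₂ * F₂ ^ b) * h1 + (X ^ (p * j) * T * F₁ * F₁ ^ a) * h2

lemma natDegree_twist_le {R : Type*} [CommRing R] {F₁ F₂ Q : R[X]} (h₁ : F₁.natDegree ≤ 2)
    (h₂ : F₂.natDegree ≤ 1) (a b n : ℕ) (hQ : Q.natDegree ≤ n) :
    (twist F₁ F₂ a b Q).natDegree ≤ n + 2 := by
  have d1 : (derivative F₁).natDegree ≤ 1 := (natDegree_derivative_le _).trans (by omega)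
  have d2 : (derivative F₂).natDegree ≤ 0 := (natDegree_derivative_le _).trans (by omega)
  have dQ : (F₁ * F₂ * derivative Q).natDegree ≤ n + 2 := by
    rcases Nat.eq_zero_or_pos Q.natDegree with h | h
    · rw [derivative_of_natDegree_zero h]; simp
    · have := natDegree_derivative_le Q
      have := natDegree_mul_le (p := F₁ * F₂) (q := derivative Q)
      have := natDegree_mul_le (p := F₁) (q := F₂)
      omega
  have e1 : ((a : R[X]) * (derivative F₁ * F₂)).natDegree ≤ 2 := by
    have := natDegree_mul_le (p := (a : R[X])) (q := derivative F₁ * F₂)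
    have := natDegree_mul_le (p := derivative F₁) (q := F₂)
    have := natDegree_natCast (R := R) a
    omega
  have e2 : ((b : R[X]) * (F₁ * derivative F₂)).natDegree ≤ 2 := by
    have := natDegree_mul_le (p := (b : R[X])) (q := F₁ * derivative F₂)
    have := natDegree_mul_le (p := F₁) (q := derivative F₂)
    have := natDegree_natCast (R := R) b
    omega
  refine natDegree_add_le_of_degree_le dQ ?_
  have := natDegree_mul_le (p := (a : R[X]) * (derivative F₁ * F₂) + (b : R[X]) * (F₁ * derivative F₂))
    (q := Q)
  have := natDegree_add_le_of_degree_le e1 e2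
  omega

lemma natDegree_twist_iterate_le {R : Type*} [CommRing R] {F₁ F₂ Q : R[X]} (h₁ : F₁.natDegree ≤ 2)
    (h₂ : F₂.natDegree ≤ 1) (a b n k : ℕ) (hQ : Q.natDegree ≤ n) :
    ((twist F₁ F₂ a b)^[k] Q).natDegree ≤ n + 2 * k := by
  induction k with
  | zero => simpa
  | succ k ih =>
    rw [Function.iterate_succ_apply']
    exact natDegree_twist_le h₁ h₂ a b _ ih

theorem stepanov_bound {p : ℕ} [Fact p.Prime] {D g J M : ℕ} (hD : D * g = p - 1)
    {F₁ F₂ : (ZMod p)[X]} (h₁ : F₁.natDegree = 2) (h₂ : F₂.natDegree = 1) (hM : M ≤ p)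
    (hcount : M * (g + J + M) < D * g * J) (S : Finset (ZMod p))
    (hS : ∀ y ∈ S, F₁.eval y ≠ 0 ∧ F₂.eval y ≠ 0 ∧ F₁.eval y ^ g = F₂.eval y ^ g) :
    S.card * M ≤ p * (J + 1) := by
  classical
  have hp2 := (Fact.out : p.Prime).two_le
  have hF1 : F₁ ≠ 0 := by rintro rfl; simp at h₁
  have hF2 : F₂ ≠ 0 := by rintro rfl; simp at h₂
  let ι := Fin g × Fin J × Fin D
  let κ := Σ k : Fin M, Fin (g + J + 2 * (k : ℕ))
  let ψ (t : ι) (k : ℕ) : (ZMod p)[X] :=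
    X ^ (t.2.1 : ℕ) * (twist F₁ F₂ (g * t.2.2) (g * (D - 1 - t.2.2)))^[k] (X ^ (t.1 : ℕ))
  have hψ : ∀ t k, (ψ t k).natDegree < g + J + 2 * k := by
    intro t k
    have ha := natDegree_twist_iterate_le h₁.le h₂.le (g * t.2.2) (g * (D - 1 - t.2.2)) t.1 k
      (Q := X ^ (t.1 : ℕ)) (by simp)
    have hb := natDegree_mul_le (p := (X : (ZMod p)[X]) ^ (t.2.1 : ℕ))
      (q := (twist F₁ F₂ (g * t.2.2) (g * (D - 1 - t.2.2)))^[k] (X ^ (t.1 : ℕ)))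
    have := natDegree_X_pow (R := ZMod p) (t.2.1 : ℕ)
    have := t.1.2
    have := t.2.1.2
    simp only [ψ]
    omega
  obtain ⟨A, hA, hA0⟩ : ∃ A : ι → ZMod p, (∀ k < M, ∑ t, C (A t) * ψ t k = 0) ∧ A ≠ 0 := by
    let L : (ι → ZMod p) →ₗ[ZMod p] (κ → ZMod p) :=
      Matrix.toLin' (Matrix.of fun (e : κ) (t : ι) => (ψ t e.1).coeff e.2)
    have hcard : Fintype.card κ < Fintype.card ι := by
      simp only [κ, ι, Fintype.card_sigma, Fintype.card_prod, Fintype.card_fin]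
      have : ∑ k : Fin M, (g + J + 2 * (k : ℕ)) ≤ M * (g + J + M) := by
        rw [Fin.sum_univ_eq_sum_range (fun k => g + J + 2 * k), Finset.sum_add_distrib,
          ← Finset.mul_sum]
        have := Finset.sum_range_id_mul_two M
        simp only [Finset.sum_const, Finset.card_range, smul_eq_mul]
        have h2 : M * (M - 1) ≤ M * M := Nat.mul_le_mul_left _ (by omega)
        nlinarith
      calc _ ≤ _ := this
        _ < _ := hcount
        _ = _ := by ring
    have hker : LinearMap.ker L ≠ ⊥ := by
      apply LinearMap.ker_ne_bot_of_finrank_lt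
      simpa using hcard
    obtain ⟨A, hAk, hA0⟩ := (Submodule.ne_bot_iff _).1 hker
    refine ⟨A, fun k hk => ?_, hA0⟩
    ext n
    simp only [finsetSum_coeff, coeff_C_mul, coeff_zero]
    by_cases hn : n < g + J + 2 * k
    · have := congrFun (LinearMap.mem_ker.1 hAk) ⟨⟨k, hk⟩, ⟨n, hn⟩⟩
      simp only [L, Matrix.toLin'_apply, Matrix.mulVec, dotProduct, Matrix.of_apply,
        Pi.zero_apply] at this
      rw [← this]
      exact Finset.sum_congr rfl fun t _ => mul_comm _ _
    · refine Finset.sum_eq_zero fun t _ => ?_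
      rw [coeff_eq_zero_of_natDegree_lt ((hψ t k).trans_le (by omega)), mul_zero]
  let φ (t : ι) : (ZMod p)[X] :=
    C (A t) * (X ^ (p * t.2.1) * X ^ (t.1 : ℕ) * F₁ ^ (g * t.2.2) * F₂ ^ (g * (D - 1 - t.2.2)))
  let P := ∑ t, φ t
  have hgD : ∀ t : ι, g * (t.2.2 : ℕ) + t.1 + 1 ≤ p - 1 := by
    intro t
    have := t.1.2
    have : g * ((t.2.2 : ℕ) + 1) ≤ g * D := Nat.mul_le_mul_left _ t.2.2.2
    rw [← hD, mul_comm D g]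
    linarith
  have hdeg : ∀ t, A t ≠ 0 →
      (φ t).natDegree = p * t.2.1 + (g * t.2.2 + t.1) + g * (D - 1) := by
    intro t ht
    have hl : g * (D - 1) = g * t.2.2 + g * (D - 1 - t.2.2) := by
      rw [← mul_add]; congr 1; have := t.2.2.2; omega
    simp only [φ]
    rw [natDegree_C_mul ht, natDegree_mul, natDegree_mul, natDegree_mul, hl]
    · simp only [natDegree_pow, natDegree_X, h₁, h₂]
      ring
    all_goals simp [hF1, hF2]
  have hφ0 : ∀ t, A t ≠ 0 → φ t ≠ 0 := by
    intro t ht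
    simp [φ, hF1, hF2, ht]
  have hP0 : P ≠ 0 := by
    obtain ⟨t₀, ht₀⟩ := Function.ne_iff.1 hA0
    have hd : P.degree = Finset.univ.sup fun t => (φ t).degree := by
      apply degree_sum_eq_of_disjoint
      rintro t ⟨-, ht⟩ t' ⟨-, ht'⟩ hne heq
      have h1 : A t ≠ 0 := by rintro h; simp [φ, h] at ht
      have h2 : A t' ≠ 0 := by rintro h; simp [φ, h] at ht'
      have heq' : (φ t).natDegree = (φ t').natDegree := natDegree_eq_of_degree_eq heq
      rw [hdeg t h1, hdeg t' h2] at heq'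
      have e0 : p * (t.2.1 : ℕ) + (g * t.2.2 + t.1) = p * t'.2.1 + (g * t'.2.2 + t'.1) := by omega
      have e1 : (g * (t.2.2 : ℕ) + t.1) = (g * t'.2.2 + t'.1) := by
        have := congrArg (· % p) e0
        simpa [Nat.mul_add_mod,
          Nat.mod_eq_of_lt (show g * (t.2.2 : ℕ) + t.1 < p by have := hgD t; omega),
          Nat.mod_eq_of_lt (show g * (t'.2.2 : ℕ) + t'.1 < p by have := hgD t'; omega)] using this
      have e2 : (t.2.1 : ℕ) = t'.2.1 := by
        have : p * (t.2.1 : ℕ) = p * t'.2.1 := by omega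
        exact Nat.eq_of_mul_eq_mul_left (by omega) this
      have e3 : (t.1 : ℕ) = t'.1 := by
        have := congrArg (· % g) e1
        simpa [Nat.mul_add_mod, Nat.mod_eq_of_lt t.1.2, Nat.mod_eq_of_lt t'.1.2] using this
      have e4 : (t.2.2 : ℕ) = t'.2.2 := by
        have : g * (t.2.2 : ℕ) = g * t'.2.2 := by omega
        exact Nat.eq_of_mul_eq_mul_left (by have := t.1.2; omega) this
      exact hne (Prod.ext (Fin.ext e3) (Prod.ext (Fin.ext e2) (Fin.ext e4)))
    intro h
    rw [h, degree_zero] at hd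
    have := Finset.le_sup (f := fun t => (φ t).degree) (Finset.mem_univ t₀)
    rw [← hd, le_bot_iff, degree_eq_bot] at this
    exact hφ0 t₀ ht₀ this
  have hPdeg : P.natDegree ≤ p * (J + 1) := by
    refine natDegree_sum_le_of_forall_le _ _ fun t _ => ?_
    by_cases ht : A t = 0
    · simp [φ, ht]
    · rw [hdeg t ht]
      have h1 := hgD t
      have h2 : p * ((t.2.1 : ℕ) + 1) ≤ p * J := Nat.mul_le_mul_left _ t.2.1.2
      have h3 : g * (D - 1) ≤ g * D := Nat.mul_le_mul_left _ (by omega)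
      rw [mul_comm g D, hD] at h3
      rw [mul_add] at h2 ⊢
      omega
  have hdvd : ∀ y ∈ S, (X - C y) ^ M ∣ P := by
    intro y hy
    obtain ⟨e1, e2, e3⟩ := hS y hy
    refine pow_dvd_of_scaledDerivative_iterate_eval_eq_zero (F₁ * F₂) P y (by simp [e1, e2]) M hM
      fun k hk => ?_
    have hsum : (scaledDerivative (F₁ * F₂))^[k] P = ∑ t : ι, C (A t) * (X ^ (p * t.2.1) *
        (twist F₁ F₂ (g * t.2.2) (g * (D - 1 - t.2.2)))^[k] (X ^ (t.1 : ℕ)) *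
          F₁ ^ (g * t.2.2) * F₂ ^ (g * (D - 1 - t.2.2))) := by
      let ℓ : (ZMod p)[X] →ₗ[ZMod p] (ZMod p)[X] :=
        (LinearMap.mulLeft (ZMod p) (F₁ * F₂)).comp derivative
      have hl : scaledDerivative (F₁ * F₂) = ⇑ℓ := rfl
      rw [hl, ← Module.End.coe_pow, map_sum]
      refine Finset.sum_congr rfl fun t _ => ?_
      simp only [φ]
      rw [← smul_eq_C_mul, map_smul, Module.End.coe_pow, ← hl, scaledDerivative_iterate_term,
        smul_eq_C_mul]
    have hz := congrArg (eval y) (hA k hk)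
    rw [hsum, eval_finsetSum]
    rw [eval_finsetSum, eval_zero] at hz
    have : ∀ t : ι, eval y (C (A t) * (X ^ (p * t.2.1) *
        (twist F₁ F₂ (g * t.2.2) (g * (D - 1 - t.2.2)))^[k] (X ^ (t.1 : ℕ)) *
          F₁ ^ (g * t.2.2) * F₂ ^ (g * (D - 1 - t.2.2)))) =
        eval y (C (A t) * ψ t k) * (F₂.eval y ^ g) ^ (D - 1) := by
      intro t
      have hl : (F₂.eval y ^ g) ^ (D - 1) =
          (F₂.eval y ^ g) ^ (t.2.2 : ℕ) * (F₂.eval y ^ g) ^ (D - 1 - t.2.2) := by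
        rw [← pow_add]; congr 1; have := t.2.2.2; omega
      have hy : y ^ (p * (t.2.1 : ℕ)) = y ^ (t.2.1 : ℕ) := by rw [pow_mul, ZMod.pow_card]
      simp only [ψ, eval_mul, eval_C, eval_pow, eval_X, hy]
      rw [hl, pow_mul (eval y F₁), pow_mul (eval y F₂) g (D - 1 - t.2.2), e3]
      ring
    simp_rw [this]
    rw [← Finset.sum_mul, hz, zero_mul]
  calc S.card * M = ∑ y ∈ S, M := by simp
    _ ≤ ∑ y ∈ S, P.roots.count y := Finset.sum_le_sum fun y hy => by
        rw [count_roots]; exact (le_rootMultiplicity_iff hP0).2 (hdvd y hy)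
    _ ≤ ∑ y ∈ P.roots.toFinset ∪ S, P.roots.count y :=
        Finset.sum_le_sum_of_subset Finset.subset_union_right
    _ = P.roots.card := Multiset.sum_count_eq_card fun a ha => by simp_all
    _ ≤ P.natDegree := card_roots' P
    _ ≤ _ := hPdeg

end Stepanov

open Polynomial

section Count

lemma stepanov_parameters_normalized {t u e Y : ℝ} (he : 0 < e) (he' : e ≤ 1 / 1000)
    (het : 2 * e ≤ t)
    (hu1 : 1 ≤ u) (hut : t ≤ u) (hu : u ≤ 1 + t) (hY : Y * (1 + 4 * t) = u + t) :
    (Y + e) * (1 + u * e + t * Y + t * e) < u * (1 - e ^ 2) := by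
  have ht : 0 < t := by linarith
  have h4 : 0 < 1 + 4 * t := by linarith
  have hYe : Y = (u + t) / (1 + 4 * t) := by field_simp; linarith
  have hY0 : 0 < Y := by rw [hYe]; positivity
  have hu0 : 0 < u := by linarith
  have hut0 : 0 < u * t := by positivity
  have hslack : 2 * u * t ≤ (u - Y - t * Y ^ 2) * (1 + 4 * t) := by
    have e1 : (u - Y - t * Y ^ 2) * (1 + 4 * t) * (1 + 4 * t) =
        t * ((4 * u - 1) * (1 + 4 * t) - (u + t) ^ 2) := by
      rw [← hY]; linear_combination (-(1 + 4 * t)) * hY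
    have e2 : 2 * u * (1 + 4 * t) ≤ (4 * u - 1) * (1 + 4 * t) - (u + t) ^ 2 := by
      nlinarith [mul_nonneg ht.le (sub_nonneg.2 hut), mul_nonneg hu0.le (sub_nonneg.2 hu),
        mul_nonneg ht.le (sub_nonneg.2 hu1)]
    have e3 := mul_le_mul_of_nonneg_left e2 ht.le
    rw [← e1] at e3
    exact le_of_mul_le_mul_right (by linarith) h4
  have herr : e * (1 + Y * u + 2 * t * Y + 2 * u * e + t * e) * (1 + 4 * t) < 2 * u * t := by
    have e1 : e * (1 + Y * u + 2 * t * Y + 2 * u * e + t * e) * (1 + 4 * t) =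
        e * ((1 + 4 * t) + (u + 2 * t) * (u + t) + (1 + 4 * t) * (2 * u + t) * e) := by
      rw [← hY]; ring
    have e2 : (1 + 4 * t) + (u + 2 * t) * (u + t) ≤ 2 * u + 10 * (u * t) := by
      nlinarith [mul_nonneg ht.le (sub_nonneg.2 hut), mul_nonneg hu0.le (sub_nonneg.2 hu),
        mul_nonneg ht.le (sub_nonneg.2 hu1)]
    have e3 : (1 + 4 * t) * (2 * u + t) ≤ 3 * u + 12 * (u * t) := by
      nlinarith [mul_nonneg ht.le (sub_nonneg.2 hut)]
    have e4 : (1 + 4 * t) * (2 * u + t) * e ≤ (3 * u + 12 * (u * t)) * (1 / 1000) := by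
      gcongr
    rw [e1]
    have e5 : (1 + 4 * t) + (u + 2 * t) * (u + t) + (1 + 4 * t) * (2 * u + t) * e ≤
        2.1 * u + 10.1 * (u * t) := by linarith
    have e6 := mul_le_mul_of_nonneg_left e5 he.le
    have e7 : e * u ≤ (t / 2) * u := by gcongr; linarith
    have e8 : e * (u * t) ≤ 1 / 1000 * (u * t) := by gcongr
    nlinarith
  have hfin : e * (1 + Y * u + 2 * t * Y + 2 * u * e + t * e) < u - Y - t * Y ^ 2 :=
    lt_of_mul_lt_mul_right (herr.trans_le hslack) h4.le
  nlinarith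

lemma stepanov_parameters {s D g J y : ℝ} (hs : 1000 ≤ s) (hD : 2 ≤ D) (hg : D * g = s ^ 2 - 1)
    (hJ1 : 1 ≤ J) (hJ : s ≤ D * J) (hJ' : D * J ≤ s + D) (hy : y * (s + 4 * D) = D * (J + 1) * s) :
    (y + 1) * (g + J + (y + 1)) < D * g * J := by
  have hs0 : 0 < s := by linarith
  have hD0 : 0 < D := by linarith
  have key := stepanov_parameters_normalized (t := D / s) (u := D * J / s) (e := 1 / s) (Y := y / s)
    (by positivity) (by gcongr) (by rw [mul_one_div]; gcongr)
    (by rw [le_div_iff₀ hs0]; linarith)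
    (by gcongr; nlinarith)
    (by rw [div_le_iff₀ hs0]; field_simp; linarith)
    (by field_simp; linarith)
  have hge : g = (s ^ 2 - 1) / D := by field_simp; linarith
  have hm := mul_lt_mul_of_pos_left key (show 0 < s ^ 3 / D by positivity)
  have l1 : s ^ 3 / D * ((y / s + 1 / s) *
      (1 + D * J / s * (1 / s) + D / s * (y / s) + D / s * (1 / s)))
      = (y + 1) * (s ^ 2 / D + J + (y + 1)) := by
    field_simp; ring
  have l2 : s ^ 3 / D * (D * J / s * (1 - (1 / s) ^ 2)) = (s ^ 2 - 1) * J := by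
    field_simp
  rw [l1, l2] at hm
  rw [hg]
  refine lt_of_le_of_lt ?_ hm
  have hy0 : 0 < y := by
    have : y = D * (J + 1) * s / (s + 4 * D) := by field_simp; linarith
    rw [this]; positivity
  have : g ≤ s ^ 2 / D := by rw [hge]; gcongr; linarith
  gcongr

lemma stepanov_card_le {p : ℕ} [Fact p.Prime] (hp : 10 ^ 6 ≤ p) {D g : ℕ} (hD : D * g = p - 1)
    (hD2 : 2 ≤ D) {F₁ F₂ : (ZMod p)[X]} (h₁ : F₁.natDegree = 2) (h₂ : F₂.natDegree = 1)
    (S : Finset (ZMod p))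
    (hS : ∀ y ∈ S, F₁.eval y ≠ 0 ∧ F₂.eval y ≠ 0 ∧ F₁.eval y ^ g = F₂.eval y ^ g) :
    (S.card : ℝ) ≤ p / D + 4 * √p := by
  set s := √(p : ℝ) with hs_def
  have hps : (p : ℝ) = s ^ 2 := (Real.sq_sqrt (by positivity)).symm
  have hs : 1000 ≤ s := by
    apply Real.le_sqrt_of_sq_le
    calc (1000 : ℝ) ^ 2 = (10 ^ 6 : ℕ) := by norm_num
      _ ≤ p := by exact_mod_cast hp
  have hs0 : 0 < s := by linarith
  have hDr : (2 : ℝ) ≤ D := by exact_mod_cast hD2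
  have hD0 : (0 : ℝ) < D := by linarith
  have hgr : (D : ℝ) * g = s ^ 2 - 1 := by
    have : D * g + 1 = p := by omega
    rw [← hps, ← this]; push_cast; ring
  set J := ⌈s / D⌉₊ with hJ_def
  have hJ1 : (1 : ℝ) ≤ J := by
    have : 0 < J := Nat.ceil_pos.2 (by positivity)
    exact_mod_cast this
  have hJ2 : s ≤ D * J := by
    have := Nat.le_ceil (s / D)
    rw [div_le_iff₀ hD0] at this
    linarith
  have hJ3 : D * J ≤ s + D := by
    have := (Nat.ceil_lt_add_one (show 0 ≤ s / D by positivity)).le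
    calc (D : ℝ) * J ≤ D * (s / D + 1) := by gcongr
      _ = s + D := by field_simp
  obtain ⟨y, hy_def⟩ : ∃ y : ℝ, y = D * (J + 1) * s / (s + 4 * D) := ⟨_, rfl⟩
  have hy : y * (s + 4 * D) = D * (J + 1) * s := by
    rw [hy_def]; exact div_mul_cancel₀ _ (by positivity)
  have hy0 : 0 < y := by rw [hy_def]; positivity
  have hys : y ≤ s := by
    rw [hy_def, div_le_iff₀ (by positivity)]; nlinarith
  set M := ⌈y⌉₊
  have hMy : y ≤ M := Nat.le_ceil y
  have hMy' : (M : ℝ) ≤ y + 1 := (Nat.ceil_lt_add_one hy0.le).le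
  have hMp : M ≤ p := by
    have : (M : ℝ) ≤ p := by rw [hps]; nlinarith
    exact_mod_cast this
  have hcount : M * (g + J + M) < D * g * J := by
    have h := stepanov_parameters hs hDr hgr hJ1 hJ2 hJ3 hy
    have : (M : ℝ) * (g + J + M) < D * g * J := by
      refine lt_of_le_of_lt ?_ h
      gcongr
    exact_mod_cast this
  have hb := stepanov_bound hD h₁ h₂ hMp hcount S hS
  have hb' : (S.card : ℝ) * M ≤ p * (J + 1) := by exact_mod_cast hb
  have h1 : (S.card : ℝ) * y ≤ p * (J + 1) :=
    le_trans (mul_le_mul_of_nonneg_left hMy (Nat.cast_nonneg _)) hb'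
  have h2 : (p / D + 4 * s) * y = p * (J + 1) := by
    calc (p / D + 4 * s) * y = s / D * (y * (s + 4 * D)) := by rw [hps]; field_simp
      _ = s ^ 2 * (J + 1) * (D / D) := by rw [hy]; ring
      _ = p * (J + 1) := by rw [div_self hD0.ne', hps, mul_one]
  rw [← h2] at h1
  exact le_of_mul_le_mul_right h1 hy0

lemma card_pow_eq_pow_le {p : ℕ} [Fact p.Prime] (hp : 10 ^ 6 ≤ p) {D g : ℕ} (hD : D * g = p - 1)
    (hD2 : 2 ≤ D) {d₁ d₂ d₃ e : ZMod p} (h₁ : d₁ ≠ e) (h₂ : d₂ ≠ e) (h₃ : d₃ ≠ e)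
    (S : Finset (ZMod p))
    (hS : ∀ x ∈ S, x + d₁ ≠ 0 ∧ x + d₂ ≠ 0 ∧ x + d₃ ≠ 0 ∧ x + e ≠ 0 ∧
      ((x + d₁) * (x + d₂)) ^ g = ((x + d₃) * (x + e)) ^ g) :
    (S.card : ℝ) ≤ p / D + 4 * √p := by
  classical
  have hinj : Set.InjOn (fun x => (x + e)⁻¹) (S : Set (ZMod p)) := by
    intro x _ y _ h
    simpa using h
  rw [← Finset.card_image_of_injOn hinj]
  have hl : ∀ d, d ≠ e → (C (d - e) * X + C 1 : (ZMod p)[X]).natDegree = 1 := fun d h =>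
    natDegree_linear (sub_ne_zero.2 h)
  have hl0 : ∀ d, d ≠ e → (C (d - e) * X + C 1 : (ZMod p)[X]) ≠ 0 := by
    intro d h h0
    have := hl d h
    rw [h0] at this
    simp at this
  refine stepanov_card_le hp hD hD2 (F₁ := (C (d₁ - e) * X + C 1) * (C (d₂ - e) * X + C 1))
    (F₂ := C (d₃ - e) * X + C 1) ?_ (hl _ h₃) _ ?_
  · rw [natDegree_mul (hl0 _ h₁) (hl0 _ h₂), hl _ h₁, hl _ h₂]
  · intro y hy
    obtain ⟨x, hx, rfl⟩ := Finset.mem_image.1 hy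
    obtain ⟨e1, e2, e3, e4, e5⟩ := hS x hx
    have hev : ∀ d, (C (d - e) * X + C 1 : (ZMod p)[X]).eval (x + e)⁻¹ = (x + d) * (x + e)⁻¹ := by
      intro d
      simp only [eval_add, eval_mul, eval_C, eval_X]
      field_simp
      ring
    rw [eval_mul, hev, hev, hev]
    have hi := inv_ne_zero e4
    refine ⟨by simp [e1, e2, e4], by simp [e3, e4], ?_⟩
    have : (x + d₁) * (x + e)⁻¹ * ((x + d₂) * (x + e)⁻¹) =
        (x + d₁) * (x + d₂) * ((x + e)⁻¹) ^ 2 := by ring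
    rw [this, mul_pow, e5, ← mul_pow]
    congr 1
    field_simp

end Count

section Moment

open Finset

lemma sum_card_fiber_sub_sq {K : Type*} [DecidableEq K] {α : Type*} [DecidableEq α]
    (T : Finset α) (Q : Finset K) (f : α → K)
    (hf : ∀ a ∈ T, f a ∈ Q) (hQ : Q.Nonempty) :
    ∑ u ∈ Q, (((#{a ∈ T | f a = u} : ℕ) : ℝ) - #T / #Q) ^ 2 =
      (#{x ∈ T ×ˢ T | f x.1 = f x.2} : ℕ) - (#T : ℝ) ^ 2 / #Q := by
  have hD : (#Q : ℝ) ≠ 0 := by exact_mod_cast hQ.card_ne_zero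
  have h1 : ∑ u ∈ Q, ((#{a ∈ T | f a = u} : ℕ) : ℝ) = #T := by
    exact_mod_cast (card_eq_sum_card_fiberwise hf).symm
  have h2 : ∑ u ∈ Q, ((#{a ∈ T | f a = u} : ℕ) : ℝ) ^ 2 =
      (#{x ∈ T ×ˢ T | f x.1 = f x.2} : ℕ) := by
    have : ∀ x ∈ ({x ∈ T ×ˢ T | f x.1 = f x.2} : Finset (α × α)), f x.1 ∈ Q := by
      intro x hx
      simp only [mem_filter, mem_product] at hx
      exact hf _ hx.1.1
    rw [card_eq_sum_card_fiberwise this]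
    push_cast
    refine sum_congr rfl fun u _ => ?_
    rw [sq, ← Nat.cast_mul, ← card_product]
    congr 2
    ext ⟨a, b⟩
    simp only [mem_filter, mem_product]
    grind
  simp_rw [sub_sq]
  rw [sum_add_distrib, sum_sub_distrib, h2, sum_const, nsmul_eq_mul, ← sum_mul, ← mul_sum, h1]
  field_simp
  ring

lemma fourth_power_discrepancy_le {K : Type*} [Field K] [DecidableEq K] (Q S : Finset K)
    (h0 : (0 : K) ∉ Q)
    (hdiv : ∀ x ∈ Q, ∀ y ∈ Q, x / y ∈ Q) (hS : S ⊆ Q) {α : Type*} [DecidableEq α] (I : Finset α)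
    (c : α → K) (hc : ∀ i ∈ I, c i ∈ Q) {t : K} (ht : t ∈ Q) :
    (((#{i ∈ I | t * c i ∈ S} : ℕ) : ℝ) - #I * #S / #Q) ^ 4 ≤
      (#S : ℝ) ^ 2 * ((#{x ∈ (I ×ˢ I) ×ˢ (I ×ˢ I) |
        c x.1.1 / c x.1.2 = c x.2.1 / c x.2.2} : ℕ) - (#I : ℝ) ^ 4 / #Q) := by
  have hQ : Q.Nonempty := ⟨t, ht⟩
  have ht0 : t ≠ 0 := fun h => h0 (h ▸ ht)
  have h1 : (1 : K) ∈ Q := by simpa [ht0] using hdiv t ht t ht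
  have hv := sum_card_fiber_sub_sq I Q c hc hQ
  have hw := sum_card_fiber_sub_sq (I ×ˢ I) Q (fun x => c x.1 / c x.2)
    (fun x hx => hdiv _ (hc _ (mem_product.1 hx).1) _ (hc _ (mem_product.1 hx).2)) hQ
  set r : ℝ := ((#{x ∈ I ×ˢ I | c x.1 = c x.2} : ℕ) : ℝ) with hr
  have hr1 : r = ((#{x ∈ I ×ˢ I | c x.1 / c x.2 = 1} : ℕ) : ℝ) := by
    rw [hr]
    congr 2
    refine filter_congr fun x hx => ?_
    rw [div_eq_one_iff_eq]
    intro h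
    exact h0 (h ▸ hc _ (mem_product.1 hx).2)
  have hsq : (r - (#I : ℝ) ^ 2 / #Q) ^ 2 ≤ (#{x ∈ (I ×ˢ I) ×ˢ (I ×ˢ I) |
        c x.1.1 / c x.1.2 = c x.2.1 / c x.2.2} : ℕ) - (#I : ℝ) ^ 4 / #Q := by
    have := single_le_sum (f := fun u => (((#{x ∈ I ×ˢ I | c x.1 / c x.2 = u} : ℕ) : ℝ) -
      #(I ×ˢ I) / #Q) ^ 2) (fun _ _ => sq_nonneg _) h1
    rw [hw, ← hr1, card_product] at this
    push_cast at this
    rwa [show ((#I : ℝ) * #I) ^ 2 = (#I : ℝ) ^ 4 by ring, ← sq] at this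
  set S' : Finset K := S.image (fun s => s / t)
  have hS' : #S' = #S := card_image_of_injective _ fun a b h => by simpa [ht0] using h
  have hS'Q : S' ⊆ Q := by
    intro x hx
    obtain ⟨s, hs, rfl⟩ := mem_image.1 hx
    exact hdiv _ (hS hs) _ ht
  have hmem : ∀ u, t * u ∈ S ↔ u ∈ S' := by
    intro u
    simp only [S', mem_image]
    constructor
    · intro h
      exact ⟨_, h, by field_simp⟩
    · rintro ⟨s, hs, rfl⟩
      rwa [mul_div_cancel₀ _ ht0]
  have hN : ((#{i ∈ I | t * c i ∈ S} : ℕ) : ℝ) - #I * #S / #Q =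
      ∑ u ∈ S', (((#{i ∈ I | c i = u} : ℕ) : ℝ) - #I / #Q) := by
    rw [sum_sub_distrib, sum_const, hS', nsmul_eq_mul]
    have : #{i ∈ I | t * c i ∈ S} = ∑ u ∈ S', #{i ∈ I | c i = u} := by
      rw [card_eq_sum_card_fiberwise (f := c) (t := S')]
      · refine sum_congr rfl fun u hu => ?_
        congr 1
        ext i
        simp only [mem_filter, hmem]
        grind
      · intro i hi
        simp only [coe_filter, Set.mem_ofPred_eq, hmem] at hi
        exact hi.2
    rw [this]
    push_cast
    ring
  have hcs := sq_sum_le_card_mul_sum_sq (s := S')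
    (f := fun u => ((#{i ∈ I | c i = u} : ℕ) : ℝ) - #I / #Q)
  rw [← hN, hS'] at hcs
  have hsub : ∑ u ∈ S', (((#{i ∈ I | c i = u} : ℕ) : ℝ) - #I / #Q) ^ 2 ≤
      r - (#I : ℝ) ^ 2 / #Q := by
    rw [← hv]
    exact sum_le_sum_of_subset_of_nonneg hS'Q fun _ _ _ => sq_nonneg _
  have h2 : (((#{i ∈ I | t * c i ∈ S} : ℕ) : ℝ) - #I * #S / #Q) ^ 2 ≤
      #S * (r - (#I : ℝ) ^ 2 / #Q) := hcs.trans (by gcongr)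
  calc _ = ((((#{i ∈ I | t * c i ∈ S} : ℕ) : ℝ) - #I * #S / #Q) ^ 2) ^ 2 := by ring
    _ ≤ (#S * (r - (#I : ℝ) ^ 2 / #Q)) ^ 2 := by gcongr
    _ = (#S : ℝ) ^ 2 * (r - (#I : ℝ) ^ 2 / #Q) ^ 2 := by ring
    _ ≤ _ := by gcongr

lemma card_degenerate_le {K : Type*} [DecidableEq K] (I : Finset K) :
    #{x ∈ (I ×ˢ I) ×ˢ (I ×ˢ I) | (x.1.1 = x.1.2 ∧ x.2.1 = x.2.2) ∨
      (x.1.1 = x.2.1 ∧ x.1.2 = x.2.2) ∨ (x.1.1 = x.2.2 ∧ x.1.2 = x.2.1)} ≤ 3 * #I ^ 2 := by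
  have : ({x ∈ (I ×ˢ I) ×ˢ (I ×ˢ I) | (x.1.1 = x.1.2 ∧ x.2.1 = x.2.2) ∨
      (x.1.1 = x.2.1 ∧ x.1.2 = x.2.2) ∨ (x.1.1 = x.2.2 ∧ x.1.2 = x.2.1)} :
        Finset ((K × K) × (K × K))) ⊆
      (I ×ˢ I).image (fun y => ((y.1, y.1), (y.2, y.2))) ∪
      ((I ×ˢ I).image (fun y => ((y.1, y.2), (y.1, y.2))) ∪
      (I ×ˢ I).image (fun y => ((y.1, y.2), (y.2, y.1)))) := by
    rintro ⟨⟨a, b⟩, c, d⟩ h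
    simp only [mem_filter, mem_product, mem_union, mem_image, Prod.exists, Prod.mk.injEq] at h ⊢
    grind
  refine (card_le_card this).trans ((card_union_le _ _).trans ?_)
  have h := card_union_le ((I ×ˢ I).image (fun y : K × K => ((y.1, y.2), (y.1, y.2))))
    ((I ×ˢ I).image (fun y : K × K => ((y.1, y.2), (y.2, y.1))))
  have h1 := card_image_le (s := I ×ˢ I) (f := fun y : K × K => ((y.1, y.1), (y.2, y.2)))
  have h2 := card_image_le (s := I ×ˢ I) (f := fun y : K × K => ((y.1, y.2), (y.1, y.2)))
  have h3 := card_image_le (s := I ×ˢ I) (f := fun y : K × K => ((y.1, y.2), (y.2, y.1)))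
  rw [card_product] at h1 h2 h3
  nlinarith

lemma card_div_eq_div_le {p : ℕ} [Fact p.Prime] (hp : 10 ^ 6 ≤ p) {D g : ℕ} (hD : D * g = p - 1)
    (hD2 : 2 ≤ D) (a b c d : ZMod p) (h : ¬ ((a = b ∧ c = d) ∨ (a = c ∧ b = d) ∨ (a = d ∧ b = c)))
    (X : Finset (ZMod p))
    (hX : ∀ x ∈ X, x + a ≠ 0 ∧ x + b ≠ 0 ∧ x + c ≠ 0 ∧ x + d ≠ 0) :
    ((#{x ∈ X | (x + a) ^ g / (x + b) ^ g = (x + c) ^ g / (x + d) ^ g} : ℕ) : ℝ) ≤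
      p / D + 4 * √p := by
  have key : ∀ x ∈ ({x ∈ X | (x + a) ^ g / (x + b) ^ g = (x + c) ^ g / (x + d) ^ g} :
      Finset (ZMod p)), x + a ≠ 0 ∧ x + b ≠ 0 ∧ x + c ≠ 0 ∧ x + d ≠ 0 ∧
        ((x + a) * (x + d)) ^ g = ((x + c) * (x + b)) ^ g := by
    intro x hx
    rw [mem_filter] at hx
    obtain ⟨h1, h2, h3, h4⟩ := hX x hx.1
    refine ⟨h1, h2, h3, h4, ?_⟩
    have := hx.2
    rw [div_eq_div_iff (pow_ne_zero _ h2) (pow_ne_zero _ h4)] at this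
    rw [mul_pow, mul_pow, this]
  by_cases ha : b ≠ a ∧ c ≠ a ∧ d ≠ a
  · refine card_pow_eq_pow_le hp hD hD2 ha.2.1 ha.1 ha.2.2 _ fun x hx => ?_
    obtain ⟨h1, h2, h3, h4, h5⟩ := key x hx
    exact ⟨h3, h2, h4, h1, by rw [← h5]; ring⟩
  by_cases hb : a ≠ b ∧ c ≠ b ∧ d ≠ b
  · refine card_pow_eq_pow_le hp hD hD2 hb.1 hb.2.2 hb.2.1 _ fun x hx => ?_
    obtain ⟨h1, h2, h3, h4, h5⟩ := key x hx
    exact ⟨h1, h4, h3, h2, h5⟩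
  by_cases hc : a ≠ c ∧ b ≠ c ∧ d ≠ c
  · refine card_pow_eq_pow_le hp hD hD2 hc.1 hc.2.2 hc.2.1 _ fun x hx => ?_
    obtain ⟨h1, h2, h3, h4, h5⟩ := key x hx
    exact ⟨h1, h4, h2, h3, by rw [h5]; ring⟩
  by_cases hd : a ≠ d ∧ b ≠ d ∧ c ≠ d
  · refine card_pow_eq_pow_le hp hD hD2 hd.2.2 hd.2.1 hd.1 _ fun x hx => ?_
    obtain ⟨h1, h2, h3, h4, h5⟩ := key x hx
    exact ⟨h3, h2, h1, h4, by rw [← h5]⟩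
  exfalso
  grind

lemma sum_quadruples_sub_le {p : ℕ} [Fact p.Prime] (hp : 10 ^ 6 ≤ p) {D g : ℕ}
    (hD : D * g = p - 1) (hD2 : 2 ≤ D) (I : Finset (ZMod p)) :
    ∑ x with ∀ b ∈ I, x + b ≠ 0, (((#{y ∈ (I ×ˢ I) ×ˢ (I ×ˢ I) |
        (x + y.1.1) ^ g / (x + y.1.2) ^ g = (x + y.2.1) ^ g / (x + y.2.2) ^ g} : ℕ) : ℝ) -
          (#I : ℝ) ^ 4 / D) ≤
      3 * (#I : ℝ) ^ 2 * p + 4 * (#I : ℝ) ^ 4 * √p + (#I : ℝ) ^ 5 / D := by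
  classical
  set X : Finset (ZMod p) := {x | ∀ b ∈ I, x + b ≠ 0} with hX_def
  have hXc : (p : ℝ) - #I ≤ #X := by
    have : univ \ I.image (fun b => -b) ⊆ X := by
      intro x hx
      simp only [mem_sdiff, mem_univ, true_and, mem_image, not_exists, not_and] at hx
      simp only [X, mem_filter, mem_univ, true_and]
      intro b hb h
      exact hx b hb (eq_neg_of_add_eq_zero_left h).symm
    have h := card_le_card this
    have h2 := le_card_sdiff (I.image (fun b => -b)) (univ : Finset (ZMod p))
    have h3 := card_image_le (s := I) (f := fun b => -b)
    rw [card_univ, ZMod.card] at h2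
    rw [sub_le_iff_le_add]
    norm_cast
    omega
  rw [sum_sub_distrib, sum_const, nsmul_eq_mul]
  have hswap : ∑ x ∈ X, ((#{y ∈ (I ×ˢ I) ×ˢ (I ×ˢ I) |
        (x + y.1.1) ^ g / (x + y.1.2) ^ g = (x + y.2.1) ^ g / (x + y.2.2) ^ g} : ℕ) : ℝ) =
      ∑ y ∈ (I ×ˢ I) ×ˢ (I ×ˢ I), ((#{x ∈ X | (x + y.1.1) ^ g / (x + y.1.2) ^ g =
        (x + y.2.1) ^ g / (x + y.2.2) ^ g} : ℕ) : ℝ) := by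
    exact_mod_cast sum_card_bipartiteAbove_eq_sum_card_bipartiteBelow _
  have hXp : (#X : ℝ) ≤ p := by
    have := card_le_univ X
    rw [ZMod.card] at this
    exact_mod_cast this
  have hbound : ∀ y ∈ (I ×ˢ I) ×ˢ (I ×ˢ I), ((#{x ∈ X | (x + y.1.1) ^ g / (x + y.1.2) ^ g =
        (x + y.2.1) ^ g / (x + y.2.2) ^ g} : ℕ) : ℝ) ≤ (p / D + 4 * √p) +
      if (y.1.1 = y.1.2 ∧ y.2.1 = y.2.2) ∨ (y.1.1 = y.2.1 ∧ y.1.2 = y.2.2) ∨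
        (y.1.1 = y.2.2 ∧ y.1.2 = y.2.1) then (p : ℝ) else 0 := by
    intro y hy
    simp only [mem_product] at hy
    split_ifs with h
    · have h1 : ((#{x ∈ X | (x + y.1.1) ^ g / (x + y.1.2) ^ g =
        (x + y.2.1) ^ g / (x + y.2.2) ^ g} : ℕ) : ℝ) ≤ #X := by
        exact_mod_cast card_filter_le _ _
      have : (0 : ℝ) ≤ p / D + 4 * √p := by positivity
      linarith
    · rw [add_zero]
      refine card_div_eq_div_le hp hD hD2 _ _ _ _ h X fun x hx => ?_
      simp only [X, mem_filter, mem_univ, true_and] at hx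
      exact ⟨hx _ hy.1.1, hx _ hy.1.2, hx _ hy.2.1, hx _ hy.2.2⟩
  have hs := sum_le_sum hbound
  rw [← hswap, sum_add_distrib, sum_const, ← sum_filter, sum_const, nsmul_eq_mul, nsmul_eq_mul,
    card_product, card_product] at hs
  have hdeg : ((#{x ∈ (I ×ˢ I) ×ˢ (I ×ˢ I) | (x.1.1 = x.1.2 ∧ x.2.1 = x.2.2) ∨
      (x.1.1 = x.2.1 ∧ x.1.2 = x.2.2) ∨ (x.1.1 = x.2.2 ∧ x.1.2 = x.2.1)} : ℕ) : ℝ) * p ≤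
      3 * (#I : ℝ) ^ 2 * p := by
    gcongr
    exact_mod_cast card_degenerate_le I
  have hlow : ((p : ℝ) - #I) * ((#I : ℝ) ^ 4 / D) ≤ #X * ((#I : ℝ) ^ 4 / D) := by gcongr
  push_cast at hs
  have e1 : ((p : ℝ) - #I) * ((#I : ℝ) ^ 4 / D) = #I * #I * (#I * #I) * (p / D) -
    (#I : ℝ) ^ 5 / D := by ring
  have e2 : (#I : ℝ) * #I * (#I * #I) * (p / D + 4 * √p) =
    #I * #I * (#I * #I) * (p / D) + 4 * (#I : ℝ) ^ 4 * √p := by ring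
  linarith

end Moment

section Burgess

open Finset

lemma card_mul_eq_mul_le (h A : ℕ) :
    ((#{x ∈ (Icc 1 h ×ˢ Icc 1 A) ×ˢ (Icc 1 h ×ˢ Icc 1 A) | x.1.1 * x.2.2 = x.2.1 * x.1.2} : ℕ) : ℝ)
      ≤ 2 * (h * A) * (harmonic A : ℝ) := by
  set R : Finset ((ℕ × ℕ) × (ℕ × ℕ)) := {x ∈ (Icc 1 h ×ˢ Icc 1 A) ×ˢ (Icc 1 h ×ˢ Icc 1 A) |
    x.1.1 * x.2.2 = x.2.1 * x.1.2} with hR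
  set P : Finset ((ℕ × ℕ) × (ℕ × ℕ)) := (Icc 1 A).biUnion fun u =>
    (Icc 1 u ×ˢ Icc 1 (A / u) ×ˢ Icc 1 (h / u)).image
      fun y => ((y.2.2 * u, y.2.1 * u), (y.2.2 * y.1, y.2.1 * y.1)) with hP
  have hmem : ∀ m a n b, ((m, a), (n, b)) ∈ R → b ≤ a → ((m, a), (n, b)) ∈ P := by
    intro m a n b hx hba
    simp only [hR, mem_filter, mem_product, mem_Icc] at hx
    obtain ⟨⟨⟨⟨hm, hmh⟩, ha, haA⟩, ⟨hn, hnh⟩, hb, hbA⟩, he⟩ := hx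
    obtain ⟨d, u, v, hd, huv, rfl, rfl⟩ := Nat.exists_coprime' (m := a) (n := b)
      (Nat.gcd_pos_of_pos_left _ ha)
    have hu : 0 < u := Nat.pos_of_mul_pos_right ha
    have hv : 0 < v := Nat.pos_of_mul_pos_right hb
    have he' : m * v = n * u := by
      apply Nat.eq_of_mul_eq_mul_right hd
      linarith
    obtain ⟨t, rfl⟩ : u ∣ m := huv.dvd_of_dvd_mul_right ⟨n, by linarith⟩
    have hn' : n = t * v := by
      apply Nat.eq_of_mul_eq_mul_right hu
      linarith
    subst hn'
    have hvu : v ≤ u := Nat.le_of_mul_le_mul_right hba hd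
    simp only [hP, mem_biUnion, mem_image, mem_product, mem_Icc, Prod.exists, Prod.mk.injEq]
    refine ⟨u, ⟨hu, ?_⟩, v, d, t, ⟨⟨hv, hvu⟩, ⟨hd, ?_⟩, ?_, ?_⟩, ⟨?_, ?_⟩, rfl, ?_⟩
    · nlinarith
    · rwa [Nat.le_div_iff_mul_le hu, mul_comm]
    · exact Nat.pos_of_mul_pos_right hn
    · rwa [Nat.le_div_iff_mul_le hu, mul_comm]
    all_goals ring
  have hsub : R ⊆ P ∪ P.image Prod.swap := by
    rintro ⟨⟨m, a⟩, n, b⟩ hx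
    rw [mem_union]
    rcases le_total b a with hab | hab
    · exact Or.inl (hmem _ _ _ _ hx hab)
    · refine Or.inr (mem_image.2 ⟨((n, b), (m, a)), hmem _ _ _ _ ?_ hab, rfl⟩)
      simp only [hR, mem_filter, mem_product] at hx ⊢
      exact ⟨hx.1.symm, hx.2.symm⟩
  have hPc : ((#P : ℕ) : ℝ) ≤ h * A * (harmonic A : ℝ) := by
    calc ((#P : ℕ) : ℝ) ≤ ∑ u ∈ Icc 1 A, (u : ℝ) * ((A / u : ℕ) * (h / u : ℕ)) := by
          have h1 : #P ≤ ∑ u ∈ Icc 1 A, u * ((A / u) * (h / u)) := by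
            refine card_biUnion_le.trans (sum_le_sum fun u _ => card_image_le.trans ?_)
            simp [card_product]
          exact_mod_cast h1
      _ ≤ ∑ u ∈ Icc 1 A, (h : ℝ) * A * (u : ℝ)⁻¹ := by
          refine sum_le_sum fun u hu => ?_
          have hu0 : (0 : ℝ) < u := by
            have := (mem_Icc.1 hu).1
            exact_mod_cast this
          calc (u : ℝ) * ((A / u : ℕ) * (h / u : ℕ)) ≤ u * ((A / u) * (h / u)) := by
                gcongr <;> exact Nat.cast_div_le
            _ = _ := by field_simp
      _ = _ := by
          rw [← mul_sum, harmonic_eq_sum_Icc]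
          push_cast
          rfl
  have h2 := (card_le_card hsub).trans (card_union_le _ _)
  have h3 : #(P.image Prod.swap) ≤ #P := card_image_le
  have h4 : ((#R : ℕ) : ℝ) ≤ 2 * (#P : ℕ) := by
    have : #R ≤ 2 * #P := by omega
    exact_mod_cast this
  linarith

lemma sum_pow_four_le {α β : Type*} [DecidableEq α] [DecidableEq β] (T : Finset α)
    (X : Finset β) (π : α → β)
    (hπ : ∀ a ∈ T, π a ∈ X) (δ : α → ℝ) (E : β → ℝ) (hE : ∀ x ∈ X, 0 ≤ E x) {C : ℝ} (hC : 0 ≤ C)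
    (h : ∀ a ∈ T, δ a ^ 4 ≤ C ^ 2 * E (π a)) :
    (∑ a ∈ T, δ a) ^ 4 ≤ (#T : ℝ) ^ 2 * C ^ 2 *
      (#{x ∈ T ×ˢ T | π x.1 = π x.2} : ℕ) * ∑ x ∈ X, E x := by
  have h1 : ∀ a ∈ T, δ a ^ 2 ≤ C * √(E (π a)) := by
    intro a ha
    have := Real.le_sqrt_of_sq_le (show (δ a ^ 2) ^ 2 ≤ C ^ 2 * E (π a) by
      rw [← pow_mul]; exact h a ha)
    rwa [Real.sqrt_mul (by positivity), Real.sqrt_sq hC] at this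
  have h2 : ∑ a ∈ T, √(E (π a)) = ∑ x ∈ X, (#{a ∈ T | π a = x} : ℕ) * √(E x) := by
    rw [← sum_fiberwise_of_maps_to hπ]
    refine sum_congr rfl fun x _ => ?_
    rw [← nsmul_eq_mul, ← sum_const]
    refine sum_congr rfl fun a ha => ?_
    rw [(mem_filter.1 ha).2]
  have h3 : ∑ x ∈ X, ((#{a ∈ T | π a = x} : ℕ) : ℝ) ^ 2 = (#{x ∈ T ×ˢ T | π x.1 = π x.2} : ℕ) := by
    have : ∀ x ∈ ({x ∈ T ×ˢ T | π x.1 = π x.2} : Finset (α × α)), π x.1 ∈ X := by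
      intro x hx
      simp only [mem_filter, mem_product] at hx
      exact hπ _ hx.1.1
    rw [card_eq_sum_card_fiberwise this]
    push_cast
    refine sum_congr rfl fun u _ => ?_
    rw [sq, ← Nat.cast_mul, ← card_product]
    congr 2
    ext ⟨a, b⟩
    simp only [mem_filter, mem_product]
    grind
  have h4 := sum_mul_sq_le_sq_mul_sq X (fun x => ((#{a ∈ T | π a = x} : ℕ) : ℝ)) (fun x => √(E x))
  rw [← h2, h3, sum_congr rfl fun x hx => Real.sq_sqrt (hE x hx)] at h4
  have h5 : (∑ a ∈ T, δ a) ^ 2 ≤ #T * (C * ∑ a ∈ T, √(E (π a))) := by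
    refine sq_sum_le_card_mul_sum_sq.trans ?_
    refine mul_le_mul_of_nonneg_left ?_ (Nat.cast_nonneg _)
    rw [mul_sum]
    exact sum_le_sum h1
  calc (∑ a ∈ T, δ a) ^ 4 = ((∑ a ∈ T, δ a) ^ 2) ^ 2 := by ring
    _ ≤ (#T * (C * ∑ a ∈ T, √(E (π a)))) ^ 2 := by gcongr
    _ = (#T : ℝ) ^ 2 * C ^ 2 * (∑ a ∈ T, √(E (π a))) ^ 2 := by ring
    _ ≤ (#T : ℝ) ^ 2 * C ^ 2 * ((#{x ∈ T ×ˢ T | π x.1 = π x.2} : ℕ) * ∑ x ∈ X, E x) := by gcongr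
    _ = _ := by ring

lemma exists_isPrimitiveRoot_zmod {p : ℕ} [Fact p.Prime] {k : ℕ} (hk : k ∣ p - 1) :
    ∃ ζ : ZMod p, IsPrimitiveRoot ζ k := by
  obtain ⟨u, hu⟩ := IsCyclic.exists_ofOrder_eq_natCard (α := (ZMod p)ˣ)
  rw [Nat.card_eq_fintype_card, ZMod.card_units] at hu
  obtain ⟨d, hd⟩ := hk
  have hp1 : 0 < p - 1 := by have := (Fact.out : p.Prime).two_le; omega
  have h := IsPrimitiveRoot.orderOf (u : ZMod p)
  rw [orderOf_units, hu] at h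
  exact ⟨_, h.pow hp1 (by rw [hd, mul_comm])⟩

open scoped Classical in
lemma burgess_fourth_power_le {p : ℕ} [Fact p.Prime] (hp : 10 ^ 6 ≤ p) {D g k : ℕ}
    (hD : D * g = p - 1) (hD2 : 2 ≤ D) (hk : k ∣ D) {h A B : ℕ} (hA : 0 < A) (hhA : h * A < p)
    (hB : h + A * B < p) :
    (∑ x ∈ Icc 1 h ×ˢ Icc 1 A, (((#{b ∈ Icc 1 B |
        IsPrimitiveRoot (((x.1 + x.2 * b : ℕ) : ZMod p) ^ g) k} : ℕ) : ℝ) -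
          B * k.totient / D)) ^ 4 ≤
      ((h : ℝ) * A) ^ 2 * (k.totient : ℝ) ^ 2 * (2 * (h * A) * (harmonic A : ℝ)) *
        (3 * (B : ℝ) ^ 2 * p + 4 * (B : ℝ) ^ 4 * √p + (B : ℝ) ^ 5 / D) := by
  have hk0 : 0 < k := Nat.pos_of_dvd_of_pos hk (by omega)
  have hBp : B < p := by nlinarith
  set Q := Polynomial.nthRootsFinset D (1 : ZMod p) with hQ
  have hmemQ : ∀ x, x ∈ Q ↔ x ^ D = 1 := fun x => Polynomial.mem_nthRootsFinset (by omega) 1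
  have hcQ : #Q = D := by
    obtain ⟨ζ, hζ⟩ := exists_isPrimitiveRoot_zmod (p := p) (k := D) ⟨g, hD.symm⟩
    exact hζ.card_nthRootsFinset
  set S := primitiveRoots k (ZMod p) with hS
  have hcS : #S = k.totient := by
    obtain ⟨ζ, hζ⟩ := exists_isPrimitiveRoot_zmod (p := p) (hk.trans ⟨g, hD.symm⟩)
    exact hζ.card_primitiveRoots
  have hSQ : S ⊆ Q := by
    intro x hx
    rw [hmemQ]
    obtain ⟨e, rfl⟩ := hk
    rw [pow_mul, ((mem_primitiveRoots hk0).1 hx).pow_eq_one, one_pow]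
  have h0 : (0 : ZMod p) ∉ Q := by
    rw [hmemQ, zero_pow (by omega)]
    exact zero_ne_one
  have hdiv : ∀ x ∈ Q, ∀ y ∈ Q, x / y ∈ Q := by
    intro x hx y hy
    rw [hmemQ] at *
    rw [div_pow, hx, hy, div_one]
  have hpow : ∀ x : ZMod p, x ≠ 0 → x ^ g ∈ Q := by
    intro x hx
    rw [hmemQ, ← pow_mul, mul_comm, hD, ZMod.pow_card_sub_one_eq_one hx]
  have hcast : ∀ n : ℕ, 0 < n → n < p → (n : ZMod p) ≠ 0 := by
    intro n hn hnp h
    rw [ZMod.natCast_eq_zero_iff] at h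
    exact absurd (Nat.le_of_dvd hn h) (by omega)
  have hinj : ∀ m n : ℕ, m < p → n < p → (m : ZMod p) = n → m = n := by
    intro m n hm hn h
    rw [ZMod.natCast_eq_natCast_iff'] at h
    rwa [Nat.mod_eq_of_lt hm, Nat.mod_eq_of_lt hn] at h
  set I : Finset (ZMod p) := (Icc 1 B).image (fun b : ℕ => (b : ZMod p)) with hI
  have hIinj : Set.InjOn (fun b : ℕ => (b : ZMod p)) (Icc 1 B : Finset ℕ) := by
    intro m hm n hn h
    rw [coe_Icc, Set.mem_Icc] at hm hn
    exact hinj m n (by omega) (by omega) h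
  have hcI : #I = B := by rw [hI, card_image_of_injOn hIinj, Nat.card_Icc]; omega
  set X : Finset (ZMod p) := {x | ∀ b ∈ I, x + b ≠ 0} with hX
  set E : ZMod p → ℝ := fun x => ((#{y ∈ (I ×ˢ I) ×ˢ (I ×ˢ I) |
        (x + y.1.1) ^ g / (x + y.1.2) ^ g = (x + y.2.1) ^ g / (x + y.2.2) ^ g} : ℕ) : ℝ) -
          (#I : ℝ) ^ 4 / D with hE
  have hXI : ∀ x ∈ X, ∀ b ∈ I, (x + b) ^ g ∈ Q := by
    intro x hx b hb
    simp only [hX, mem_filter, mem_univ, true_and] at hx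
    exact hpow _ (hx b hb)
  have hE0 : ∀ x ∈ X, 0 ≤ E x := by
    intro x hx
    have h1 : (1 : ZMod p) ∈ Q := by rw [hmemQ, one_pow]
    have := fourth_power_discrepancy_le Q {1} h0 hdiv (by simpa using h1) I
      (fun b => (x + b) ^ g) (hXI x hx) h1
    rw [card_singleton, hcQ] at this
    norm_num at this
    refine le_trans (by positivity) (this.trans (le_of_eq ?_))
    simp [hE]
  set T := Icc 1 h ×ˢ Icc 1 A with hT
  have hTc : (#T : ℝ) = h * A := by simp [hT, card_product]
  set π : ℕ × ℕ → ZMod p := fun x => (x.1 : ZMod p) / x.2 with hπ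
  have hTne : ∀ x ∈ T, (x.2 : ZMod p) ≠ 0 := by
    intro x hx
    simp only [hT, mem_product, mem_Icc] at hx
    exact hcast _ (by omega) (by nlinarith)
  have hsplit : ∀ x ∈ T, ∀ b : ℕ, ((x.1 + x.2 * b : ℕ) : ZMod p) = x.2 * (π x + b) := by
    intro x hx b
    have := hTne x hx
    simp only [hπ]
    push_cast
    field_simp
  have hπX : ∀ x ∈ T, π x ∈ X := by
    intro x hx
    simp only [hX, mem_filter, mem_univ, true_and, hI, forall_mem_image]
    intro b hb h
    have h2 := hsplit x hx b
    rw [h, mul_zero] at h2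
    simp only [hT, mem_product, mem_Icc] at hx hb
    refine hcast _ (by omega) ?_ h2
    nlinarith [Nat.mul_le_mul hx.2.2 hb.2]
  have hδ : ∀ x ∈ T, (((#{b ∈ Icc 1 B |
        IsPrimitiveRoot (((x.1 + x.2 * b : ℕ) : ZMod p) ^ g) k} : ℕ) : ℝ) -
          B * k.totient / D) ^ 4 ≤ (k.totient : ℝ) ^ 2 * E (π x) := by
    intro x hx
    have := fourth_power_discrepancy_le Q S h0 hdiv hSQ I
      (fun b => (π x + b) ^ g) (hXI _ (hπX x hx)) (hpow _ (hTne x hx))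
    rw [hcQ, hcS, hcI] at this
    have hcard : #{i ∈ I | (x.2 : ZMod p) ^ g * (π x + i) ^ g ∈ S} = #{b ∈ Icc 1 B |
        IsPrimitiveRoot (((x.1 + x.2 * b : ℕ) : ZMod p) ^ g) k} := by
      rw [hI, filter_image, card_image_of_injOn
        (hIinj.mono fun b hb => mem_coe.2 (mem_filter.1 (mem_coe.1 hb)).1)]
      congr 1
      refine filter_congr fun b _ => ?_
      rw [hsplit x hx, mul_pow, hS, mem_primitiveRoots hk0]
    rw [hcard] at this
    rw [hE, hcI]
    exact this
  have hmain := sum_pow_four_le T X π hπX _ E hE0 (Nat.cast_nonneg k.totient) hδ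
  have hen : ((#{x ∈ T ×ˢ T | π x.1 = π x.2} : ℕ) : ℝ) ≤ 2 * (h * A) * (harmonic A : ℝ) := by
    refine le_trans ?_ (card_mul_eq_mul_le h A)
    norm_cast
    refine card_le_card ?_
    intro y hy
    rw [mem_filter, mem_product] at hy
    rw [mem_filter]
    refine ⟨mem_product.2 hy.1, ?_⟩
    have h1 := hy.2
    simp only [hπ] at h1
    rw [div_eq_div_iff (hTne _ hy.1.1) (hTne _ hy.1.2)] at h1
    simp only [hT, mem_product, mem_Icc] at hy
    refine hinj _ _ ?_ ?_ (by push_cast; exact h1)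
    · exact lt_of_le_of_lt (Nat.mul_le_mul hy.1.1.1.2 hy.1.2.2.2) hhA
    · exact lt_of_le_of_lt (Nat.mul_le_mul hy.1.2.1.2 hy.1.1.2.2) hhA
  have hsum := sum_quadruples_sub_le hp hD hD2 I
  rw [hcI] at hsum
  have hsum' : ∑ x ∈ X, E x ≤
      3 * (B : ℝ) ^ 2 * p + 4 * (B : ℝ) ^ 4 * √p + (B : ℝ) ^ 5 / D := by
    simp only [hE, hcI]
    exact hsum
  rw [hTc] at hmain
  refine hmain.trans ?_
  have : 0 ≤ ∑ x ∈ X, E x := sum_nonneg hE0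
  exact mul_le_mul (mul_le_mul_of_nonneg_left hen (by positivity)) hsum' this
    (mul_nonneg (by positivity) ((Nat.cast_nonneg _).trans hen))

end Burgess

section Sieve

open Finset

lemma orderOf_eq_of_isPrimitiveRoot_of_not {G : Type*} [Field G] {N : ℕ} (hN : N ≠ 0)
    {C R : Finset ℕ} (hCR : C ∪ R = N.primeFactors) (hC : (∏ l ∈ C, l) ∣ N)
    (hR : ∀ q ∈ R, (∏ l ∈ C, l) * q ∣ N) {x : G}
    (h : IsPrimitiveRoot (x ^ (N / ∏ l ∈ C, l)) (∏ l ∈ C, l))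
    (h' : ∀ q ∈ R, ¬ IsPrimitiveRoot (x ^ (N / ((∏ l ∈ C, l) * q))) (∏ l ∈ C, l)) :
    orderOf x = N := by
  set k := ∏ l ∈ C, l with hk
  have hN0 : 0 < N := Nat.pos_of_ne_zero hN
  have hk0 : 0 < k := Nat.pos_of_dvd_of_pos hC hN0
  refine orderOf_eq_of_pow_and_pow_div_prime hN0 ?_ ?_
  · have := h.pow_eq_one
    rwa [← pow_mul, Nat.div_mul_cancel hC] at this
  intro q hq hqN hx
  have hmem : q ∈ C ∪ R := by rw [hCR]; exact Nat.mem_primeFactors.2 ⟨hq, hqN, hN⟩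
  rcases mem_union.1 hmem with hqC | hqR
  · obtain ⟨e, he⟩ : q ∣ k := dvd_prod_of_mem _ hqC
    obtain ⟨f, hf⟩ := hC
    have he0 : 0 < e := by
      rcases Nat.eq_zero_or_pos e with h0 | h0
      · simp [h0] at he; omega
      · exact h0
    rw [hf, Nat.mul_div_cancel_left _ hk0] at h
    rw [hf, he, mul_assoc, Nat.mul_div_cancel_left _ hq.pos, mul_comm, pow_mul] at hx
    have := Nat.le_of_dvd he0 (h.dvd_of_pow_eq_one e hx)
    nlinarith [hq.two_le]
  · obtain ⟨f, hf⟩ := hR q hqR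
    refine h' q hqR ?_
    have e1 : N / (k * q) = f := by rw [hf, Nat.mul_div_cancel_left _ (Nat.mul_pos hk0 hq.pos)]
    have e2 : N / k = f * q := by
      rw [hf, mul_assoc, Nat.mul_div_cancel_left _ hk0, mul_comm]
    have e3 : N / q = f * k := by
      rw [hf, mul_comm k q, mul_assoc, Nat.mul_div_cancel_left _ hq.pos, mul_comm]
    rw [e1]
    rw [e2, pow_mul] at h
    rw [e3, pow_mul] at hx
    refine ⟨hx, fun l hl => h.dvd_of_pow_eq_one l ?_⟩
    rw [← pow_mul, mul_comm q l, pow_mul, hl, one_pow]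

theorem exists_orderOf_eq_of_sieve {p : ℕ} [Fact p.Prime] (hp : 10 ^ 6 ≤ p) {C R : Finset ℕ}
    (hCR : C ∪ R = (p - 1).primeFactors) (hdisj : Disjoint C R) (hk2 : 2 ≤ ∏ l ∈ C, l)
    {h A B : ℕ} (hA : 0 < A) (hhA : h * A < p) (hB : h + A * B < p) {ε : ℝ} (hε : 0 ≤ ε)
    (hε4 : ((h : ℝ) * A) ^ 2 * ((∏ l ∈ C, l).totient : ℝ) ^ 2 * (2 * (h * A) * (harmonic A : ℝ)) *
        (3 * (B : ℝ) ^ 2 * p + 4 * (B : ℝ) ^ 4 * √p + (B : ℝ) ^ 5 / 2) ≤ ε ^ 4)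
    (hmain : (#R + 1) * ε <
      h * A * B * ((∏ l ∈ C, l).totient / (∏ l ∈ C, l : ℕ)) * (1 - ∑ q ∈ R, (1 / q : ℝ))) :
    ∃ n : ℕ, 0 < n ∧ n ≤ h + A * B ∧ orderOf (n : ZMod p) = p - 1 := by
  classical
  set k := ∏ l ∈ C, l with hk
  have hk0 : 0 < k := by omega
  have hN : p - 1 ≠ 0 := by omega
  have hpr : ∀ q ∈ C ∪ R, q.Prime ∧ q ∣ p - 1 := by
    intro q hq
    rw [hCR] at hq
    exact ⟨Nat.prime_of_mem_primeFactors hq, Nat.dvd_of_mem_primeFactors hq⟩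
  have hkN : k ∣ p - 1 := prod_primes_dvd _ (fun q hq => (hpr q (mem_union_left _ hq)).1.prime)
    (fun q hq => (hpr q (mem_union_left _ hq)).2)
  have hkq : ∀ q ∈ R, k * q ∣ p - 1 := by
    intro q hq
    have hqp := hpr q (mem_union_right _ hq)
    refine Nat.Coprime.mul_dvd_of_dvd_of_dvd ?_ hkN hqp.2
    refine Nat.Coprime.prod_left fun l hl => ?_
    rw [Nat.coprime_primes (hpr l (mem_union_left _ hl)).1 hqp.1]
    rintro rfl
    exact disjoint_left.1 hdisj hl hq
  set T := Icc 1 h ×ˢ Icc 1 A with hT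
  have hTc : (#T : ℝ) = h * A := by simp [hT, card_product]
  let F : ℕ → ℝ := fun D => ∑ x ∈ T, ((#{b ∈ Icc 1 B |
        IsPrimitiveRoot (((x.1 + x.2 * b : ℕ) : ZMod p) ^ ((p - 1) / D)) k} : ℕ) : ℝ)
  have hF : ∀ D, 2 ≤ D → k ∣ D → D ∣ p - 1 → |F D - h * A * B * (k.totient / D)| ≤ ε := by
    intro D hD2 hkD hDp
    have hb := burgess_fourth_power_le hp (Nat.mul_div_cancel' hDp) hD2 hkD hA hhA hB
    rw [sum_sub_distrib, sum_const, nsmul_eq_mul, hTc] at hb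
    have hb' : (F D - h * A * B * (k.totient / D)) ^ 4 ≤ ε ^ 4 := by
      refine le_trans (le_of_eq ?_) (hb.trans (le_trans ?_ hε4))
      · simp only [F]
        congr 1
        ring
      · have : (0 : ℝ) ≤ (harmonic A : ℝ) := by
          exact_mod_cast (harmonic_pos (by omega)).le
        have hD2' : (2 : ℝ) ≤ D := by exact_mod_cast hD2
        gcongr
    rw [← (show Even 4 by decide).pow_abs] at hb'
    exact le_of_pow_le_pow_left₀ (by norm_num) hε hb'
  by_contra! hno
  have hcover : F k ≤ ∑ q ∈ R, F (k * q) := by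
    simp only [F]
    rw [sum_comm]
    refine sum_le_sum fun x hx => ?_
    rw [← Nat.cast_sum, Nat.cast_le]
    refine le_trans (card_le_card ?_) card_biUnion_le
    intro b hb
    rw [mem_filter] at hb
    simp only [mem_biUnion, mem_filter]
    by_contra! hcon
    simp only [hT, mem_product, mem_Icc] at hx
    have hb1 := mem_Icc.1 hb.1
    refine hno (x.1 + x.2 * b) (by omega) ?_ ?_
    · exact Nat.add_le_add hx.1.2 (Nat.mul_le_mul hx.2.2 hb1.2)
    · exact orderOf_eq_of_isPrimitiveRoot_of_not hN hCR hkN hkq hb.2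
        (fun q hq => hcon q hq hb.1)
  have h1 := abs_le.1 (hF k hk2 dvd_rfl hkN)
  have h2 : ∀ q ∈ R, F (k * q) ≤ h * A * B * (k.totient / k) * (1 / q : ℝ) + ε := by
    intro q hq
    have hq2 := (hpr q (mem_union_right _ hq)).1.two_le
    have := (abs_le.1 (hF (k * q) (by nlinarith) (dvd_mul_right _ _) (hkq q hq))).2
    have e : (h : ℝ) * A * B * (k.totient / (k * q : ℕ)) =
      h * A * B * (k.totient / k) * (1 / q : ℝ) := by
      push_cast
      field_simp
    rw [e] at this
    linarith
  have h3 := sum_le_sum h2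
  rw [sum_add_distrib, ← mul_sum, sum_const, nsmul_eq_mul] at h3
  linarith

end Sieve

section Parameters

open Finset

lemma moment_parameter_bound {s q p : ℝ} (hs : 1000 ≤ s) (hq : q ≤ 25 * (s + 1) ^ 2)
    (hp : p ≤ 625 * (s + 1) ^ 4) :
    2 * s * (3 * (6 * s) ^ 2 * p + 4 * (6 * s) ^ 4 * q + (6 * s) ^ 5 / 2) ≤
      12 * ((13 * s ^ 2 - 2) * (2 * s)) * (6 * s) ^ 4 := by
  have hs0 : 0 ≤ s := by linarith
  calc _ ≤ 2 * s * (3 * (6 * s) ^ 2 * (625 * (s + 1) ^ 4) +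
        4 * (6 * s) ^ 4 * (25 * (s + 1) ^ 2) + (6 * s) ^ 5 / 2) := by gcongr
    _ ≤ _ := by
      obtain ⟨t, rfl⟩ : ∃ t, s = 1000 + t := ⟨s - 1000, by ring⟩
      have ht : 0 ≤ t := by linarith
      rw [← sub_nonneg]
      ring_nf
      positivity

lemma one_add_log_two_mul_le {s₀ s : ℝ} (hs₀ : 1 ≤ s₀) (h : s₀ ≤ s) :
    1 + Real.log (2 * s) ≤ (1 + Real.log (2 * s₀)) * (s / s₀) := by
  have h0 : 0 < s₀ := by linarith
  have hr : 1 ≤ s / s₀ := by rwa [le_div_iff₀ h0, one_mul]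
  have e : 2 * s = 2 * s₀ * (s / s₀) := by field_simp
  have h1 : Real.log (2 * s) = Real.log (2 * s₀) + Real.log (s / s₀) := by
    rw [e, Real.log_mul (by positivity) (by positivity)]
  have h2 := Real.log_le_sub_one_of_pos (show 0 < s / s₀ by linarith)
  have h3 : 0 ≤ Real.log (2 * s₀) := Real.log_nonneg (by linarith)
  rw [h1]
  nlinarith

theorem leastPrimitiveRoot_le_of_sieve {p : ℕ} (hp : p.Prime) {s₀ : ℕ} (hs₀ : 1000 ≤ s₀)
    (hs₀p : 625 * s₀ ^ 4 ≤ p) {C R : Finset ℕ} (hCR : C ∪ R = (p - 1).primeFactors)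
    (hdisj : Disjoint C R) (hk2 : 2 ≤ ∏ l ∈ C, l) (hδ : 0 < 1 - ∑ q ∈ R, (1 / q : ℝ))
    (hmain : ((#R : ℝ) + 1) ^ 4 * (∏ l ∈ C, l : ℕ) ^ 4 * (12 * (1 + Real.log (2 * s₀))) <
      ((∏ l ∈ C, l).totient : ℝ) ^ 2 * s₀ * (1 - ∑ q ∈ R, (1 / q : ℝ)) ^ 4) :
    (leastPrimitiveRoot p : ℝ) ≤ √p - 2 := by
  have := Fact.mk hp
  obtain ⟨s, hsp, hps⟩ : ∃ s : ℕ, 625 * s ^ 4 ≤ p ∧ p < 625 * (s + 1) ^ 4 := by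
    refine ⟨Nat.findGreatest (fun s => 625 * s ^ 4 ≤ p) p,
      Nat.findGreatest_spec (P := fun s => 625 * s ^ 4 ≤ p) (Nat.zero_le _) (by simp), ?_⟩
    by_contra! hcon
    have h1 : Nat.findGreatest (fun s => 625 * s ^ 4 ≤ p) p + 1 ≤ p := by
      refine le_trans ?_ hcon
      have := Nat.le_self_pow (show 4 ≠ 0 by norm_num)
        (Nat.findGreatest (fun s => 625 * s ^ 4 ≤ p) p + 1)
      omega
    have := Nat.le_findGreatest (P := fun s => 625 * s ^ 4 ≤ p) h1 hcon
    omega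
  have hss : s₀ ≤ s := by
    by_contra! hlt
    have : 625 * (s + 1) ^ 4 ≤ 625 * s₀ ^ 4 := by gcongr; omega
    omega
  have hs : 1000 ≤ s := hs₀.trans hss
  have hsr : (1000 : ℝ) ≤ s := by exact_mod_cast hs
  have hs0 : (0 : ℝ) < s := by linarith
  have hs2 : 1000000 ≤ s ^ 2 := by nlinarith
  obtain ⟨h, hh⟩ : ∃ h : ℕ, h + 2 = 13 * s ^ 2 := ⟨13 * s ^ 2 - 2, by omega⟩
  have hhr : (h : ℝ) = 13 * s ^ 2 - 2 := by
    rw [eq_sub_iff_add_eq]; exact_mod_cast hh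
  have hsum : h + 2 * s * (6 * s) + 2 = 25 * s ^ 2 := by
    have : 2 * s * (6 * s) = 12 * s ^ 2 := by ring
    omega
  have hs4 : s ^ 4 = s ^ 2 * s ^ 2 := by ring
  have hh0 : (0 : ℝ) < h := by
    have : 0 < h := by omega
    exact_mod_cast this
  have hsqrt1 : (25 : ℝ) * s ^ 2 ≤ √p := by
    apply Real.le_sqrt_of_sq_le
    calc ((25 : ℝ) * s ^ 2) ^ 2 = (625 * s ^ 4 : ℕ) := by push_cast; ring
      _ ≤ p := by exact_mod_cast hsp
  have hsqrt2 : √p ≤ 25 * ((s : ℝ) + 1) ^ 2 := by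
    rw [Real.sqrt_le_left (by positivity)]
    calc (p : ℝ) ≤ (625 * (s + 1) ^ 4 : ℕ) := by exact_mod_cast hps.le
      _ = _ := by push_cast; ring
  have hp625 : (p : ℝ) ≤ 625 * ((s : ℝ) + 1) ^ 4 := by exact_mod_cast hps.le
  set k := ∏ l ∈ C, l with hk
  set δ : ℝ := 1 - ∑ q ∈ R, (1 / q : ℝ) with hδ_def
  set L := 1 + Real.log (2 * s) with hL
  have hlog : 0 ≤ Real.log (2 * s) := Real.log_nonneg (by linarith)
  have hL0 : 0 < L := by linarith
  have hH : (harmonic (2 * s) : ℝ) ≤ L := by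
    refine (harmonic_le_one_add_log _).trans (le_of_eq ?_)
    push_cast; rfl
  have hk0 : (0 : ℝ) < k := by
    have : 0 < k := by omega
    exact_mod_cast this
  have hφ0 : (0 : ℝ) < k.totient := by
    have : 0 < k.totient := Nat.totient_pos.2 (by omega)
    exact_mod_cast this
  set φ : ℝ := (k.totient : ℝ) with hφ
  set τ := √√(12 * L / s) with hτ
  have hτ4 : τ ^ 4 = 12 * L / s := by
    rw [show τ ^ 4 = (τ ^ 2) ^ 2 by ring, hτ, Real.sq_sqrt (Real.sqrt_nonneg _),
      Real.sq_sqrt (by positivity)]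
  have hφ4 : √φ ^ 4 = φ ^ 2 := by
    rw [show √φ ^ 4 = (√φ ^ 2) ^ 2 by ring, Real.sq_sqrt hφ0.le]
  have hB0 : (0 : ℝ) < h * (2 * s : ℕ) * (6 * s : ℕ) := by push_cast; positivity
  obtain ⟨n, hn0, hn, hord⟩ := exists_orderOf_eq_of_sieve (p := p) (C := C) (R := R) (h := h)
      (A := 2 * s) (B := 6 * s) (ε := h * (2 * s : ℕ) * (6 * s : ℕ) * (√φ * τ))
      (by nlinarith) hCR hdisj hk2 (by omega) (by
        refine lt_of_lt_of_le ?_ hsp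
        calc h * (2 * s) < (13 * s ^ 2) * (2 * s) := by
              apply Nat.mul_lt_mul_of_pos_right <;> omega
          _ = 26 * s ^ 3 * 1 := by ring
          _ ≤ 625 * s ^ 3 * s := by gcongr <;> omega
          _ = 625 * s ^ 4 := by ring) (by nlinarith) (by positivity) (by
        rw [mul_pow _ (√φ * τ), mul_pow √φ, hφ4, hτ4]
        push_cast
        have hb := moment_parameter_bound hsr hsqrt2 hp625
        rw [← hhr] at hb
        have hW : (0 : ℝ) ≤ 3 * (6 * s) ^ 2 * p + 4 * (6 * s) ^ 4 * √p + (6 * s) ^ 5 / 2 := by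
          positivity
        calc _ ≤ ((h : ℝ) * (2 * s)) ^ 2 * φ ^ 2 * (2 * (h * (2 * s)) * L) *
              (3 * (6 * s) ^ 2 * p + 4 * (6 * s) ^ 4 * √p + (6 * s) ^ 5 / 2) := by gcongr
          _ = ((h : ℝ) * (2 * s)) ^ 3 * φ ^ 2 * L / s * (2 * s *
              (3 * (6 * s) ^ 2 * p + 4 * (6 * s) ^ 4 * √p + (6 * s) ^ 5 / 2)) := by
            field_simp
          _ ≤ ((h : ℝ) * (2 * s)) ^ 3 * φ ^ 2 * L / s *
              (12 * (h * (2 * s)) * (6 * s) ^ 4) := by gcongr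
          _ = _ := by ring) (by
        have hlt : ((#R : ℝ) + 1) * (√φ * τ) < φ / k * δ := by
          refine lt_of_pow_lt_pow_left₀ 4 (by positivity) ?_
          rw [mul_pow, mul_pow √φ, hφ4, hτ4, mul_pow, div_pow]
          have h1 := one_add_log_two_mul_le (s₀ := s₀) (s := s)
            (by norm_cast; omega) (by exact_mod_cast hss)
          have hs₀r : (0 : ℝ) < s₀ := by norm_cast; omega
          have h2 : ((#R : ℝ) + 1) ^ 4 * (k : ℝ) ^ 4 * (12 * L) < φ ^ 2 * s * δ ^ 4 := by
            calc ((#R : ℝ) + 1) ^ 4 * (k : ℝ) ^ 4 * (12 * L) ≤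
                  ((#R : ℝ) + 1) ^ 4 * (k : ℝ) ^ 4 *
                    (12 * ((1 + Real.log (2 * s₀)) * (s / s₀))) := by gcongr
              _ = ((#R : ℝ) + 1) ^ 4 * (k : ℝ) ^ 4 *
                    (12 * (1 + Real.log (2 * s₀))) * (s / s₀) := by ring
              _ < φ ^ 2 * s₀ * δ ^ 4 * (s / s₀) := by gcongr
              _ = _ := by field_simp
          calc ((#R : ℝ) + 1) ^ 4 * (φ ^ 2 * (12 * L / s)) =
                ((#R : ℝ) + 1) ^ 4 * (k : ℝ) ^ 4 * (12 * L) * (φ ^ 2 / (s * k ^ 4)) := by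
                field_simp
            _ < φ ^ 2 * s * δ ^ 4 * (φ ^ 2 / (s * k ^ 4)) := by gcongr
            _ = _ := by field_simp
        calc _ = h * (2 * s : ℕ) * (6 * s : ℕ) * (((#R : ℝ) + 1) * (√φ * τ)) := by ring
          _ < h * (2 * s : ℕ) * (6 * s : ℕ) * (φ / k * δ) := by gcongr
          _ = _ := by ring)
  have hle : leastPrimitiveRoot p ≤ n := Nat.sInf_le ⟨hn0, hord⟩
  have h3 : leastPrimitiveRoot p + 2 ≤ 25 * s ^ 2 := by omega
  have h4 : (leastPrimitiveRoot p : ℝ) + 2 ≤ 25 * s ^ 2 := by exact_mod_cast h3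
  linarith

end Parameters

section Certificates

open Finset

lemma pow_card_mul_prod_le {Q U : Finset ℕ} {Y : ℕ} (hQ : ∀ q ∈ Q, q < Y → q ∈ U)
    (hU : ∀ u ∈ U, u ≤ Y) : Y ^ #Q * ∏ u ∈ U, u ≤ Y ^ #U * ∏ q ∈ Q, q := by
  have h1 : Y ^ #(Q \ U) ≤ ∏ q ∈ Q \ U, q := by
    refine pow_card_le_prod _ _ _ fun q hq => ?_
    rw [mem_sdiff] at hq
    by_contra! h
    exact hq.2 (hQ q hq.1 h)
  have h2 : ∏ u ∈ U \ Q, u ≤ Y ^ #(U \ Q) :=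
    prod_le_pow_card _ _ _ fun u hu => hU u (mem_sdiff.1 hu).1
  rw [← prod_inter_mul_prod_sdiff U Q, ← prod_inter_mul_prod_sdiff Q U, inter_comm U Q,
    ← card_inter_add_card_sdiff Q U, ← card_inter_add_card_sdiff U Q, inter_comm U Q, pow_add,
    pow_add]
  calc _ = Y ^ #(Q ∩ U) * (∏ q ∈ Q ∩ U, q) * (Y ^ #(Q \ U) * ∏ u ∈ U \ Q, u) := by ring
    _ ≤ Y ^ #(Q ∩ U) * (∏ q ∈ Q ∩ U, q) * ((∏ q ∈ Q \ U, q) * Y ^ #(U \ Q)) := by gcongr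
    _ = _ := by ring

lemma sum_one_div_le {R U : Finset ℕ} {Y : ℕ} (hR : ∀ q ∈ R, q < Y → q ∈ U)
    (hY : 0 < Y) (hU : ∀ u ∈ U, 0 < u ∧ u ≤ Y) :
    ∑ q ∈ R, (1 / q : ℝ) ≤ #R / Y + ∑ u ∈ U, (1 / u - 1 / Y : ℝ) := by
  have hYr : (0 : ℝ) < Y := by exact_mod_cast hY
  have h0 : ∀ u ∈ U, (0 : ℝ) ≤ 1 / u - 1 / Y := by
    intro u hu
    have h1 : (0 : ℝ) < u := by exact_mod_cast (hU u hu).1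
    have h2 : (u : ℝ) ≤ Y := by exact_mod_cast (hU u hu).2
    rw [sub_nonneg]
    exact one_div_le_one_div_of_le h1 h2
  have h1 : ∑ q ∈ R, (1 / q - 1 / Y : ℝ) ≤ ∑ u ∈ U, (1 / u - 1 / Y : ℝ) := by
    rw [← sum_inter_add_sum_sdiff R U]
    have h2 : ∑ q ∈ R \ U, (1 / q - 1 / Y : ℝ) ≤ 0 := by
      refine sum_nonpos fun q hq => ?_
      rw [mem_sdiff] at hq
      have : Y ≤ q := by
        by_contra! h
        exact hq.2 (hR q hq.1 h)
      rw [sub_nonpos]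
      exact one_div_le_one_div_of_le hYr (by exact_mod_cast this)
    have h3 : ∑ q ∈ R ∩ U, (1 / q - 1 / Y : ℝ) ≤ ∑ u ∈ U, (1 / u - 1 / Y : ℝ) :=
      sum_le_sum_of_subset_of_nonneg inter_subset_right fun u hu _ => h0 u hu
    linarith
  rw [sum_sub_distrib, sum_const, nsmul_eq_mul] at h1
  have e : (#R : ℝ) * (1 / Y) = #R / Y := by ring
  linarith

lemma totient_prod_primes {C : Finset ℕ} (hC : ∀ l ∈ C, l.Prime) :
    (∏ l ∈ C, l).totient = ∏ l ∈ C, (l - 1) := by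
  induction C using Finset.induction_on with
  | empty => simp
  | insert a C ha ih =>
    rw [prod_insert ha, prod_insert ha, Nat.totient_mul, ih fun l hl => hC l (mem_insert_of_mem hl),
      Nat.totient_prime (hC a (mem_insert_self _ _))]
    refine Nat.Coprime.prod_right fun l hl => ?_
    rw [Nat.coprime_primes (hC a (mem_insert_self _ _)) (hC l (mem_insert_of_mem hl))]
    rintro rfl
    exact ha hl

lemma sq_prod_mul_prod_sub_one_le {C U : Finset ℕ} (hC : ∀ l ∈ C, l.Prime) (hCU : C ⊆ U)
    (hU : ∀ u ∈ U, 1 ≤ u) :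
    (∏ l ∈ C, l) ^ 2 * ∏ u ∈ U, (u - 1) ≤ (∏ u ∈ U, u ^ 2) * (∏ l ∈ C, l).totient := by
  rw [totient_prod_primes hC, ← prod_sdiff hCU, ← prod_sdiff hCU, ← prod_pow]
  have : ∏ u ∈ U \ C, (u - 1) ≤ ∏ u ∈ U \ C, u ^ 2 := by
    refine prod_le_prod' fun u hu => ?_
    have := hU u (mem_sdiff.1 hu).1
    nlinarith [Nat.sub_le u 1]
  calc _ = (∏ l ∈ C, l ^ 2) * (∏ l ∈ C, (l - 1)) * ∏ u ∈ U \ C, (u - 1) := by ring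
    _ ≤ (∏ l ∈ C, l ^ 2) * (∏ l ∈ C, (l - 1)) * ∏ u ∈ U \ C, u ^ 2 := by gcongr
    _ = _ := by ring

lemma prod_primes_le_two_mul_totient_sq {C : Finset ℕ} (hC : ∀ l ∈ C, l.Prime) :
    ∏ l ∈ C, l ≤ 2 * (∏ l ∈ C, l).totient ^ 2 := by
  rw [totient_prod_primes hC]
  have h1 : ∏ l ∈ C, l ≤ ∏ l ∈ C, ((if l = 2 then 2 else 1) * (l - 1) ^ 2) := by
    refine prod_le_prod' fun l hl => ?_
    have h2 := (hC l hl).two_le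
    obtain ⟨m, rfl⟩ : ∃ m, l = m + 2 := ⟨l - 2, by omega⟩
    split_ifs with h
    · have : m = 0 := by omega
      simp [this]
    · have : 1 ≤ m := by omega
      rw [show m + 2 - 1 = m + 1 by omega]
      nlinarith
  refine h1.trans ?_
  rw [prod_mul_distrib, prod_pow]
  gcongr
  rw [prod_ite_eq' C 2 (fun _ => 2)]
  split_ifs <;> norm_num

lemma two_mem_primeFactors_sub_one {p : ℕ} (hp : p.Prime) (hp2 : 2 < p) :
    2 ∈ (p - 1).primeFactors := by
  rw [Nat.mem_primeFactors]
  refine ⟨Nat.prime_two, ?_, by omega⟩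
  have := hp.eq_two_or_odd
  omega

lemma card_filter_not_lt_add_one_le {p z : ℕ} (hp : p.Prime) (hp2 : 2 < p) (hz : 3 ≤ z) :
    #{q ∈ (p - 1).primeFactors | ¬ q < z} + 1 ≤ #(p - 1).primeFactors := by
  have h1 := card_filter_add_card_filter_not (s := (p - 1).primeFactors) (fun l => l < z)
  have h2 : 0 < #{q ∈ (p - 1).primeFactors | q < z} :=
    card_pos.2 ⟨2, mem_filter.2 ⟨two_mem_primeFactors_sub_one hp hp2, hz⟩⟩
  omega

lemma leastPrimitiveRoot_le_of_bounds {p : ℕ} (hp : p.Prime) {z : ℕ} (hz : 3 ≤ z) {s₀ : ℕ}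
    (hs₀ : 1000 ≤ s₀) (hs₀p : 625 * s₀ ^ 4 ≤ p) {κ d : ℝ} (hd : 0 < d)
    (hκ : ((∏ l ∈ (p - 1).primeFactors with l < z, l : ℕ) : ℝ) ^ 4 ≤
      κ * ((∏ l ∈ (p - 1).primeFactors with l < z, l).totient : ℝ) ^ 2)
    (hR : ∑ q ∈ (p - 1).primeFactors with ¬ q < z, (1 / q : ℝ) + d ≤ 1)
    (hfin : (#(p - 1).primeFactors : ℝ) ^ 4 * κ * (12 * (1 + Real.log (2 * s₀))) < s₀ * d ^ 4) :
    (leastPrimitiveRoot p : ℝ) ≤ √p - 2 := by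
  set C := {l ∈ (p - 1).primeFactors | l < z} with hC
  set R := {l ∈ (p - 1).primeFactors | ¬ l < z} with hRdef
  have hs₀1 : 1 ≤ s₀ ^ 4 := Nat.one_le_pow _ _ (by omega)
  have hp2 : 2 < p := by omega
  have h2C : 2 ∈ C := mem_filter.2 ⟨two_mem_primeFactors_sub_one hp hp2, hz⟩
  have hpos : ∀ l ∈ C, 0 < l := fun l hl => (Nat.prime_of_mem_primeFactors (mem_filter.1 hl).1).pos
  have hk0 : 0 < ∏ l ∈ C, l := prod_pos hpos
  have hk2 : 2 ≤ ∏ l ∈ C, l := Nat.le_of_dvd hk0 (dvd_prod_of_mem _ h2C)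
  have hcard' : (#R : ℝ) + 1 ≤ #(p - 1).primeFactors := by
    exact_mod_cast card_filter_not_lt_add_one_le hp hp2 hz
  have hφ0 : (0 : ℝ) < (∏ l ∈ C, l).totient := by exact_mod_cast Nat.totient_pos.2 hk0
  have hlog : 0 ≤ Real.log (2 * s₀) :=
    Real.log_nonneg (by norm_cast; omega)
  refine leastPrimitiveRoot_le_of_sieve hp hs₀ hs₀p (filter_union_filter_not_eq _ _)
    (disjoint_filter_filter_not _ _ _) hk2 (by linarith) ?_
  calc _ ≤ (#(p - 1).primeFactors : ℝ) ^ 4 * (κ * ((∏ l ∈ C, l).totient : ℝ) ^ 2) *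
        (12 * (1 + Real.log (2 * s₀))) := by gcongr
    _ = (#(p - 1).primeFactors : ℝ) ^ 4 * κ * (12 * (1 + Real.log (2 * s₀))) *
      ((∏ l ∈ C, l).totient : ℝ) ^ 2 := by ring
    _ < s₀ * d ^ 4 * ((∏ l ∈ C, l).totient : ℝ) ^ 2 := by gcongr
    _ = ((∏ l ∈ C, l).totient : ℝ) ^ 2 * s₀ * d ^ 4 := by ring
    _ ≤ _ := by
      gcongr
      linarith

/-- The integers in `[a, b)` surviving trial division by the primes below `47`, together with these
primes. -/
def sievedIco (a b : ℕ) : Finset ℕ :=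
  {n ∈ Ico a b | n ∈ [2, 3, 5, 7, 11, 13, 17, 19, 23, 29, 31, 37, 41, 43] ∨
    Nat.gcd n 13082761331670030 = 1}

lemma mem_sievedIco_of_prime {a b q : ℕ} (hq : q.Prime) (ha : a ≤ q) (hb : q < b) :
    q ∈ sievedIco a b := by
  rw [sievedIco, mem_filter, mem_Ico]
  refine ⟨⟨ha, hb⟩, or_iff_not_imp_right.2 fun h => ?_⟩
  have hdvd : q ∣ [2, 3, 5, 7, 11, 13, 17, 19, 23, 29, 31, 37, 41, 43].prod := by
    rw [← Nat.coprime_iff_gcd_eq_one, hq.coprime_iff_not_dvd, not_not] at h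
    exact h
  obtain ⟨l, hl, hql⟩ := (hq.prime.dvd_prod_iff).1 hdvd
  have hlp : l.Prime := by
    have : ∀ l ∈ [2, 3, 5, 7, 11, 13, 17, 19, 23, 29, 31, 37, 41, 43], Nat.Prime l := by
      simp only [List.forall_mem_cons, List.not_mem_nil]
      norm_num
    exact this l hl
  rwa [(Nat.prime_dvd_prime_iff_eq hq hlp).1 hql]

lemma bounds_of_mem_sievedIco {a b u : ℕ} (hu : u ∈ sievedIco a b) : a ≤ u ∧ u < b :=
  mem_Ico.1 (mem_filter.1 hu).1

lemma le_of_prod_sievedIco_le {p n₀ X M : ℕ} (hX : 0 < X) (h0 : n₀ ≤ #(p - 1).primeFactors)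
    (hp : 1 < p) (hM : M * X ^ #(sievedIco 2 X) ≤ X ^ n₀ * ∏ u ∈ sievedIco 2 X, u) : M ≤ p := by
  have h1 := pow_card_mul_prod_le (Q := (p - 1).primeFactors) (U := sievedIco 2 X) (Y := X)
    (fun q hq hqX => mem_sievedIco_of_prime (Nat.prime_of_mem_primeFactors hq)
      (Nat.prime_of_mem_primeFactors hq).two_le hqX)
    (fun u hu => (bounds_of_mem_sievedIco hu).2.le)
  have h2 : ∏ q ∈ (p - 1).primeFactors, q ≤ p - 1 :=
    Nat.le_of_dvd (by omega) (Nat.prod_primeFactors_dvd _)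
  have h3 : M * X ^ #(sievedIco 2 X) ≤ (p - 1) * X ^ #(sievedIco 2 X) := by
    calc _ ≤ X ^ n₀ * ∏ u ∈ sievedIco 2 X, u := hM
      _ ≤ X ^ #(p - 1).primeFactors * ∏ u ∈ sievedIco 2 X, u := by gcongr
      _ ≤ X ^ #(sievedIco 2 X) * (p - 1) := h1.trans (by gcongr)
      _ = _ := by ring
  have := Nat.le_of_mul_le_mul_right h3 (by positivity)
  omega

theorem leastPrimitiveRoot_le_of_certificate {p n₀ n₁ z X Y s₀ b D : ℕ} (hp : p.Prime)
    (h0 : n₀ ≤ #(p - 1).primeFactors) (h1 : #(p - 1).primeFactors ≤ n₁) (hz : 3 ≤ z) (hX : 0 < X)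
    (hY : 0 < Y) (hs₀ : 1000 ≤ s₀) (hD : 0 < D)
    (hP : 625 * s₀ ^ 4 * X ^ #(sievedIco 2 X) ≤ X ^ n₀ * ∏ u ∈ sievedIco 2 X, u)
    (hb : 2 * s₀ ≤ 2 ^ b)
    (hrec : Y * ∑ u ∈ sievedIco z Y, (10 ^ 6 / u + 1) + 10 ^ 6 * n₁ + D * Y ≤
      10 ^ 6 * Y + 10 ^ 6 * #(sievedIco z Y) + 10 ^ 6)
    (hfin : n₁ ^ 4 * (∏ u ∈ sievedIco 2 z, u ^ 2) ^ 2 * 12 * (10000 + 6932 * b) * (10 ^ 6) ^ 4 <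
      10000 * s₀ * D ^ 4 * (∏ u ∈ sievedIco 2 z, (u - 1)) ^ 2) :
    (leastPrimitiveRoot p : ℝ) ≤ √p - 2 := by
  set A := ∏ u ∈ sievedIco 2 z, u ^ 2 with hA
  set B := ∏ u ∈ sievedIco 2 z, (u - 1) with hB
  have hB0 : 0 < B := prod_pos fun u hu => by
    have := (bounds_of_mem_sievedIco hu).1
    omega
  have hBr : (0 : ℝ) < B := by exact_mod_cast hB0
  have hYr : (0 : ℝ) < Y := by exact_mod_cast hY
  have hDr : (0 : ℝ) < D := by exact_mod_cast hD
  have hprime : ∀ l ∈ ({l ∈ (p - 1).primeFactors | l < z} : Finset ℕ), l.Prime := fun l hl =>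
    Nat.prime_of_mem_primeFactors (mem_filter.1 hl).1
  have hs₀p := le_of_prod_sievedIco_le hX h0 hp.one_lt hP
  have hp2 : 2 < p := by
    have := Nat.one_le_pow 4 s₀ (by omega)
    omega
  refine leastPrimitiveRoot_le_of_bounds hp hz hs₀ hs₀p (κ := (A / B) ^ 2) (d := D / 10 ^ 6)
    (by positivity) ?_ ?_ ?_
  · have h2 := sq_prod_mul_prod_sub_one_le hprime (U := sievedIco 2 z)
      (fun l hl => mem_sievedIco_of_prime (hprime l hl) (hprime l hl).two_le (mem_filter.1 hl).2)
      (fun u hu => one_le_two.trans (bounds_of_mem_sievedIco hu).1)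
    rw [← hA, ← hB] at h2
    have h3 : ((∏ l ∈ (p - 1).primeFactors with l < z, l : ℕ) : ℝ) ^ 2 ≤
        A / B * (∏ l ∈ (p - 1).primeFactors with l < z, l).totient := by
      rw [div_mul_eq_mul_div, le_div_iff₀ hBr]
      exact_mod_cast h2
    calc _ = (((∏ l ∈ (p - 1).primeFactors with l < z, l : ℕ) : ℝ) ^ 2) ^ 2 := by ring
      _ ≤ (A / B * (∏ l ∈ (p - 1).primeFactors with l < z, l).totient : ℝ) ^ 2 := by gcongr
      _ = _ := by ring
  · have hcard := (card_filter_not_lt_add_one_le hp hp2 hz).trans h1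
    have h2 := sum_one_div_le (R := {q ∈ (p - 1).primeFactors | ¬ q < z}) (U := sievedIco z Y)
      (Y := Y) (fun q hq hqY => mem_sievedIco_of_prime
        (Nat.prime_of_mem_primeFactors (mem_filter.1 hq).1) (not_lt.1 (mem_filter.1 hq).2) hqY)
      hY (fun u hu => by have := bounds_of_mem_sievedIco hu; omega)
    have h3 : ∑ u ∈ sievedIco z Y, (1 / u : ℝ) ≤
        (∑ u ∈ sievedIco z Y, (10 ^ 6 / u + 1) : ℕ) / 10 ^ 6 := by
      rw [Nat.cast_sum, sum_div]
      refine sum_le_sum fun u hu => ?_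
      have hu0 : 0 < u := by have := bounds_of_mem_sievedIco hu; omega
      have hur : (0 : ℝ) < u := by exact_mod_cast hu0
      rw [div_le_div_iff₀ hur (by norm_num), one_mul]
      have := (Nat.lt_div_mul_add (a := 10 ^ 6) hu0).le
      rw [← Nat.succ_mul] at this
      exact_mod_cast this
    rw [sum_sub_distrib, sum_const, nsmul_eq_mul] at h2
    have hcardr : (#{q ∈ (p - 1).primeFactors | ¬ q < z} : ℝ) ≤ n₁ - 1 := by
      rw [le_sub_iff_add_le]
      exact_mod_cast hcard
    have hrecr : (Y : ℝ) * (∑ u ∈ sievedIco z Y, (10 ^ 6 / u + 1) : ℕ) + 10 ^ 6 * n₁ + D * Y ≤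
      10 ^ 6 * Y + 10 ^ 6 * #(sievedIco z Y) + 10 ^ 6 := by exact_mod_cast hrec
    calc _ ≤ ((n₁ - 1 : ℝ) / Y + ((∑ u ∈ sievedIco z Y, (10 ^ 6 / u + 1) : ℕ) / 10 ^ 6 -
          #(sievedIco z Y) * (1 / Y))) + D / 10 ^ 6 := by
          gcongr
          refine h2.trans ?_
          gcongr
      _ = (Y * (∑ u ∈ sievedIco z Y, (10 ^ 6 / u + 1) : ℕ) + 10 ^ 6 * n₁ + D * Y -
          10 ^ 6 * #(sievedIco z Y) - 10 ^ 6) / (10 ^ 6 * Y) := by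
          field_simp
          ring
      _ ≤ 1 := by
          rw [div_le_one (by positivity)]
          linarith
  · have hlog : Real.log (2 * s₀) ≤ 0.6932 * b := by
      calc Real.log (2 * s₀) ≤ Real.log (2 ^ b) := by
            apply Real.log_le_log (by norm_cast; omega)
            exact_mod_cast hb
        _ = b * Real.log 2 := Real.log_pow _ _
        _ ≤ b * 0.6932 := by
            gcongr
            linarith [Real.log_two_lt_d9]
        _ = _ := mul_comm _ _
    have hfinr : (n₁ : ℝ) ^ 4 * A ^ 2 * 12 * (10000 + 6932 * b) * (10 ^ 6) ^ 4 <
      10000 * s₀ * D ^ 4 * B ^ 2 := by exact_mod_cast hfin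
    have h1r : (#(p - 1).primeFactors : ℝ) ≤ n₁ := by exact_mod_cast h1
    have hlog0 : 0 ≤ Real.log (2 * s₀) := Real.log_nonneg (by norm_cast; omega)
    calc _ ≤ (n₁ : ℝ) ^ 4 * (A / B) ^ 2 * (12 * (1 + 0.6932 * b)) := by gcongr
      _ = (n₁ : ℝ) ^ 4 * A ^ 2 * 12 * (10000 + 6932 * b) * (10 ^ 6) ^ 4 /
          (10000 * (10 ^ 6) ^ 4 * B ^ 2) := by
          field_simp
          ring
      _ < 10000 * s₀ * D ^ 4 * B ^ 2 / (10000 * (10 ^ 6) ^ 4 * B ^ 2) := by gcongr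
      _ = _ := by
          field_simp

lemma leastPrimitiveRoot_le_of_card_le {p : ℕ} (hp : p.Prime) (h0 : 42 ≤ #(p - 1).primeFactors)
    (h1 : #(p - 1).primeFactors ≤ 1400) : (leastPrimitiveRoot p : ℝ) ≤ √p - 2 := by
  rcases Nat.lt_or_ge 42 #(p - 1).primeFactors with h42 | h42
  swap
  · exact leastPrimitiveRoot_le_of_certificate (z := 7) (X := 181) (Y := 193) (s₀ := 3 * 10 ^ 17)
      (b := 60) (D := 94378) hp h0 h42 (by norm_num) (by norm_num) (by norm_num) (by norm_num)
      (by norm_num) (by decide +kernel) (by norm_num) (by decide +kernel) (by decide +kernel)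
  rcases Nat.lt_or_ge 46 #(p - 1).primeFactors with h46 | h46
  swap
  · exact leastPrimitiveRoot_le_of_certificate (z := 7) (X := 191) (Y := 223)
      (s₀ := 11 * 10 ^ 17) (b := 61) (D := 75050) hp h42 h46 (by norm_num) (by norm_num)
      (by norm_num) (by norm_num) (by norm_num) (by decide +kernel) (by norm_num)
      (by decide +kernel) (by decide +kernel)
  rcases Nat.lt_or_ge 82 #(p - 1).primeFactors with h82 | h82
  swap
  · exact leastPrimitiveRoot_le_of_certificate (z := 11) (X := 211) (Y := 439)
      (s₀ := 22 * 10 ^ 19) (b := 69) (D := 100764) hp h46 h82 (by norm_num) (by norm_num)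
      (by norm_num) (by norm_num) (by norm_num) (by decide +kernel) (by norm_num)
      (by decide +kernel) (by decide +kernel)
  rcases Nat.lt_or_ge 783 #(p - 1).primeFactors with h783 | h783
  swap
  · exact leastPrimitiveRoot_le_of_certificate (z := 31) (X := 431) (Y := 2209)
      (s₀ := 67 * 10 ^ 41) (b := 144) (D := 18824) hp h82 h783 (by norm_num) (by norm_num)
      (by norm_num) (by norm_num) (by norm_num) (by decide +kernel) (by norm_num)
      (by decide +kernel) (by decide +kernel)
  · exact leastPrimitiveRoot_le_of_certificate (z := 200) (X := 2209) (Y := 2209)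
      (s₀ := 2 ^ 2024) (b := 2025) (D := 138831) hp h783 h1 (by norm_num) (by norm_num)
      (by norm_num) (by decide +kernel) (by norm_num) (by decide +kernel) (by decide +kernel)
      (by decide +kernel) (by decide +kernel)

end Certificates

section LargeCard

open Finset

lemma two_div_le_log_add_one_sub_log {x : ℝ} (hx : 0 < x) :
    2 / (2 * x + 1) ≤ Real.log (x + 1) - Real.log x := by
  have h := Real.hasSum_log_one_add_inv hx
  have h1 := h.summable.sum_le_tsum {0} fun k _ => by positivity
  rw [h.tsum_eq, sum_singleton] at h1
  rw [← Real.log_div (by positivity) hx.ne', show (x + 1) / x = 1 + x⁻¹ by field_simp]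
  refine le_trans (le_of_eq ?_) h1
  norm_num
  ring

lemma sum_one_div_odd_le {m : ℕ} (hm : 0 < m) (n : ℕ) :
    ∑ i ∈ range n, (1 / (2 * m + 1 + 2 * i : ℕ) : ℝ) ≤
      (Real.log (m + n) - Real.log m) / 2 := by
  induction n with
  | zero => simp
  | succ n ih =>
    rw [sum_range_succ]
    have := two_div_le_log_add_one_sub_log (x := m + n) (by positivity)
    have e : (1 / (2 * m + 1 + 2 * n : ℕ) : ℝ) = 2 / (2 * (m + n) + 1) / 2 := by
      push_cast
      field_simp
      ring
    rw [e, Nat.cast_succ, ← add_assoc]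
    linarith

lemma sum_one_div_primeFactors_le {N m : ℕ} (hm : 0 < m) (hN : #N.primeFactors ≤ 6 * m) :
    ∑ q ∈ N.primeFactors with ¬ q < 2 * m + 1, (1 / q : ℝ) + 1 / 40 ≤ 1 := by
  set n := #N.primeFactors
  have hinj : Set.InjOn (fun i => 2 * m + 1 + 2 * i) (range n : Set ℕ) := fun i _ j _ h => by
    simp only at h
    omega
  have h1 := sum_one_div_le (R := {q ∈ N.primeFactors | ¬ q < 2 * m + 1})
    (U := (range n).image fun i => 2 * m + 1 + 2 * i) (Y := 2 * m + 1 + 2 * n) (fun q hq hqY => by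
      rw [mem_filter, Nat.mem_primeFactors] at hq
      have := hq.1.1.eq_two_or_odd
      exact mem_image.2 ⟨(q - (2 * m + 1)) / 2, mem_range.2 (by omega), by omega⟩)
    (by omega) (fun u hu => by
      obtain ⟨i, hi, rfl⟩ := mem_image.1 hu
      have := mem_range.1 hi
      omega)
  rw [sum_image hinj, sum_sub_distrib, sum_const, card_range, nsmul_eq_mul] at h1
  have h2 : (#{q ∈ N.primeFactors | ¬ q < 2 * m + 1} / (2 * m + 1 + 2 * n : ℕ) : ℝ) ≤
      n * (1 / (2 * m + 1 + 2 * n : ℕ)) := by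
    rw [mul_one_div]
    gcongr ?_ / _
    exact_mod_cast card_le_card (filter_subset _ _)
  have h3 := sum_one_div_odd_le hm n
  have hmr : (0 : ℝ) < m := by exact_mod_cast hm
  have h4 : Real.log (m + n) - Real.log m ≤ 39 / 20 := by
    rw [← Real.log_div (by positivity) hmr.ne']
    calc Real.log ((m + n) / m) ≤ Real.log 7 := by
          apply Real.log_le_log (by positivity)
          rw [div_le_iff₀ hmr]
          have : (n : ℝ) ≤ 6 * m := by exact_mod_cast hN
          linarith
      _ = Real.log (7 ^ 20) / 20 := by
          rw [Real.log_pow]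
          push_cast
          ring
      _ ≤ 39 / 20 := by
          gcongr
          rw [Real.log_le_iff_le_exp (by positivity), ← mul_one (39 : ℝ),
            show (39 : ℝ) * 1 = (39 : ℕ) * 1 by norm_num, Real.exp_nat_mul]
          calc (7 : ℝ) ^ 20 ≤ 2.718 ^ 39 := by norm_num
            _ ≤ _ := by
              gcongr
              linarith [Real.exp_one_gt_d9]
  linarith

lemma prod_primes_le_two_pow {C : Finset ℕ} {m : ℕ} (hC : ∀ l ∈ C, l.Prime ∧ l < 2 * m + 1) :
    ∏ l ∈ C, l ≤ 2 ^ (4 * m) := by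
  calc ∏ l ∈ C, l ≤ primorial (2 * m) := by
        refine prod_le_prod_of_subset_of_one_le' (fun l hl => ?_) fun l hl _ => ?_
        · exact mem_filter.2 ⟨mem_range.2 (hC l hl).2, (hC l hl).1⟩
        · exact (mem_filter.1 hl).2.one_le
    _ ≤ 4 ^ (2 * m) := primorial_le_four_pow _
    _ = 2 ^ (4 * m) := by
        rw [show 4 = 2 ^ 2 by norm_num, ← pow_mul]
        ring_nf

lemma leastPrimitiveRoot_le_of_le_card {p : ℕ} (hp : p.Prime)
    (hn : 1400 ≤ #(p - 1).primeFactors) : (leastPrimitiveRoot p : ℝ) ≤ √p - 2 := by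
  obtain ⟨n, hn'⟩ : ∃ n, n = #(p - 1).primeFactors := ⟨_, rfl⟩
  rw [← hn'] at hn
  obtain ⟨m, hm, hm'⟩ : ∃ m, n ≤ 6 * m ∧ 6 * m ≤ n + 5 := ⟨(n + 5) / 6, by omega, by omega⟩
  obtain ⟨t, ht, ht'⟩ : ∃ t, 4 * t + 1730 ≤ 10 * n ∧ 10 * n ≤ 4 * t + 1733 :=
    ⟨(10 * n - 1730) / 4, by omega, by omega⟩
  have hP : 625 * (2 ^ t) ^ 4 ≤ p := by
    refine le_of_prod_sievedIco_le (n₀ := n) (X := 1024) (by norm_num) hn'.le hp.one_lt ?_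
    have hcard : #(sievedIco 2 1024) = 172 := by decide +kernel
    have hprod : 1 ≤ ∏ u ∈ sievedIco 2 1024, u := by
      refine Nat.succ_le_of_lt (prod_pos fun u hu => ?_)
      have := bounds_of_mem_sievedIco hu
      omega
    have hpow : ∀ k, 1024 ^ k = 2 ^ (10 * k) := fun k => by
      rw [pow_mul]
      norm_num
    rw [hcard, hpow, hpow]
    calc 625 * (2 ^ t) ^ 4 * 2 ^ (10 * 172) ≤ 2 ^ 10 * (2 ^ t) ^ 4 * 2 ^ (10 * 172) := by
          gcongr
          norm_num
      _ = 2 ^ (4 * t + 1730) := by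
          rw [← pow_mul, ← pow_add, ← pow_add]
          congr 1
          ring
      _ ≤ 2 ^ (10 * n) * 1 := by
          rw [mul_one]
          exact Nat.pow_le_pow_right two_pos ht
      _ ≤ _ := by gcongr
  have hprime : ∀ l ∈ ({l ∈ (p - 1).primeFactors | l < 2 * m + 1} : Finset ℕ),
      l.Prime ∧ l < 2 * m + 1 := fun l hl =>
    ⟨Nat.prime_of_mem_primeFactors (mem_filter.1 hl).1, (mem_filter.1 hl).2⟩
  refine leastPrimitiveRoot_le_of_bounds hp (z := 2 * m + 1) (by omega) (s₀ := 2 ^ t)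
    ?_ hP (κ := 2 ^ (12 * m + 1)) (d := 1 / 40) (by norm_num) ?_
    (sum_one_div_primeFactors_le (by omega) (by omega)) ?_
  · calc 1000 ≤ 2 ^ 10 := by norm_num
      _ ≤ 2 ^ t := by
        gcongr
        · norm_num
        · omega
  · have h1 := prod_primes_le_two_pow hprime
    have h2 := prod_primes_le_two_mul_totient_sq fun l hl => (hprime l hl).1
    set k := ∏ l ∈ (p - 1).primeFactors with l < 2 * m + 1, l
    have h3 : k ^ 4 ≤ 2 ^ (12 * m + 1) * k.totient ^ 2 := by
      calc k ^ 4 = k ^ 3 * k := by ring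
        _ ≤ (2 ^ (4 * m)) ^ 3 * (2 * k.totient ^ 2) := by gcongr
        _ = _ := by ring
    exact_mod_cast h3
  · rw [← hn']
    have hlog : Real.log (2 * (2 ^ t : ℕ)) ≤ t + 1 := by
      have e : (2 * (2 ^ t : ℕ) : ℝ) = 2 ^ (t + 1) := by push_cast; ring
      rw [e, Real.log_pow]
      have := Real.log_two_lt_d9
      push_cast
      nlinarith
    have htn : (t : ℝ) + 2 ≤ 3 * n := by
      have : t + 2 ≤ 3 * n := by omega
      exact_mod_cast this
    have hn5 : n ≤ 2 ^ (6 + n / 64) := by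
      have := Nat.lt_two_pow_self (n := n / 64)
      rw [pow_add]
      omega
    have hmain : n ^ 5 * 2 ^ (12 * m + 1) * (36 * 40 ^ 4) < 2 ^ t := by
      calc n ^ 5 * 2 ^ (12 * m + 1) * (36 * 40 ^ 4) <
            n ^ 5 * 2 ^ (12 * m + 1) * 2 ^ 27 := by
            gcongr
            norm_num
        _ ≤ (2 ^ (6 + n / 64)) ^ 5 * 2 ^ (12 * m + 1) * 2 ^ 27 := by gcongr
        _ = 2 ^ ((6 + n / 64) * 5 + (12 * m + 1) + 27) := by
            rw [← pow_mul, ← pow_add, ← pow_add]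
        _ ≤ 2 ^ t := by
            gcongr
            · norm_num
            · omega
    have hmainr : (n : ℝ) ^ 5 * 2 ^ (12 * m + 1) * (36 * 40 ^ 4) < 2 ^ t := by
      exact_mod_cast hmain
    calc _ ≤ (n : ℝ) ^ 4 * 2 ^ (12 * m + 1) * (12 * (3 * n)) := by
          gcongr
          linarith
      _ = (n : ℝ) ^ 5 * 2 ^ (12 * m + 1) * (36 * 40 ^ 4) * (1 / 40) ^ 4 := by ring
      _ < 2 ^ t * (1 / 40) ^ 4 := by gcongr
      _ = _ := by push_cast; ring

end LargeCard

theorem grosswald_many_factors (p : ℕ) (hp : p.Prime)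
    (hω : 42 ≤ (p - 1).primeFactors.card) :
    (leastPrimitiveRoot p : ℝ) ≤ Real.sqrt p - 2 := by
  rcases Nat.le_total (p - 1).primeFactors.card 1400 with h | h
  · exact leastPrimitiveRoot_le_of_card_le hp hω h
  · exact leastPrimitiveRoot_le_of_le_card hp h
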